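/- arXiv:1211.2762 — 5 statements merged into one kernel-verified Lean document; each statement's English description precedes it below -/
import Mathlib

section
/- Let 1 < p < (n+2)/(n−2). Assume ψ satisfies (H1)–(H2), lim_{r→∞} ψ'(r)/ψ(r) = l ∈ (0, +∞], and, in case l = +∞, that the function [log(ψ'(r)/ψ(r))]' is bounded as r → ∞. Let u be a radial solution with u(r) > 0 for all r ≥ 0 that does not belong to the radial energy space. If ∫₀^∞ ψ(s)/ψ'(s) ds < ∞, then lim_{r→∞} u(r) exists and is a strictly positive real number. -/
open Real MeasureTheory Filter Set Asymptotics

noncomputable section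

/-- (H1): ψ is C² on [0,∞), ψ(0) = ψ''(0) = 0, ψ'(0) = 1, ψ > 0 on (0,∞). -/
def H1 (ψ : ℝ → ℝ) : Prop :=
  ContDiffOn ℝ 2 ψ (Ici 0) ∧ ψ 0 = 0 ∧ deriv ψ 0 = 1 ∧
    deriv (deriv ψ) 0 = 0 ∧ ∀ r > (0 : ℝ), 0 < ψ r

/-- (H2): ψ' ≥ 0 on (0,∞). -/
def H2 (ψ : ℝ → ℝ) : Prop := ∀ r > (0 : ℝ), 0 ≤ deriv ψ r

/-- (H3): liminf_{r→∞} ψ'(r)/ψ(r) > 0, i.e. ψ'/ψ is eventually bounded below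
by a positive constant. -/
def H3 (ψ : ℝ → ℝ) : Prop := ∃ c > (0 : ℝ), ∀ᶠ r in atTop, c ≤ deriv ψ r / ψ r

/-- A radial solution of the Lane–Emden–Fowler equation with initial value α. -/
def IsRadialSolution (n : ℕ) (p : ℝ) (ψ u : ℝ → ℝ) (α : ℝ) : Prop :=
  ContDiffOn ℝ 2 u (Ici 0) ∧ u 0 = α ∧ deriv u 0 = 0 ∧
    ∀ r > (0 : ℝ), deriv (deriv u) r + ((n : ℝ) - 1) * (deriv ψ r / ψ r) * deriv u r
      + |u r| ^ (p - 1) * u r = 0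

/-- `u` belongs to the radial energy space. -/
def InEnergySpace (n : ℕ) (ψ u : ℝ → ℝ) : Prop :=
  IntegrableOn (fun r => ((u r) ^ 2 + (deriv u r) ^ 2) * ψ r ^ (n - 1)) (Ioi 0)

/-- [log(ψ'/ψ)]' is bounded as r → ∞. -/
def LogDerivBounded (ψ : ℝ → ℝ) : Prop :=
  ∃ C : ℝ, ∀ᶠ r in atTop, |deriv (fun s => Real.log (deriv ψ s / ψ s)) r| ≤ C

theorem le_of_hasDerivAt_neg_of_eq {f f' : ℝ → ℝ} {a K : ℝ}
    (hf : ∀ x ≥ a, HasDerivAt f (f' x) x) (ha : f a ≤ K)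
    (hK : ∀ x ≥ a, f x = K → f' x < 0) : ∀ x ≥ a, f x ≤ K := by
  intro x hx
  exact image_le_of_deriv_right_lt_deriv_boundary' (f := f) (f' := f') (a := a) (b := x)
    (B := fun _ => K) (B' := fun _ => 0)
    (fun y hy => (hf y hy.1).continuousAt.continuousWithinAt)
    (fun y hy => (hf y hy.1).hasDerivWithinAt) ha continuousOn_const
    (fun y _ => hasDerivWithinAt_const _ _ _) (fun y hy h => hK y hy.1 h) ⟨hx, le_rfl⟩

theorem exists_le_of_hasDerivAt_le_neg_one {f f' : ℝ → ℝ} {a c : ℝ}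
    (hf : ∀ x ≥ a, HasDerivAt f (f' x) x)
    (hc : ∀ x ≥ a, c ≤ f x → f' x ≤ -1) : ∃ x ≥ a, f x ≤ c := by
  by_contra! h
  have hanti : AntitoneOn (fun x => f x + x) (Ici a) := by
    have hd : ∀ x ≥ a, HasDerivAt (fun x => f x + x) (f' x + 1) x :=
      fun x hx => (hf x hx).add (hasDerivAt_id x)
    refine antitoneOn_of_hasDerivWithinAt_nonpos (f' := fun x => f' x + 1) (convex_Ici a)
      (fun x hx => (hd x hx).continuousAt.continuousWithinAt) ?_ ?_
    · intro x hx
      rw [interior_Ici] at hx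
      exact (hd x hx.le).hasDerivWithinAt
    · intro x hx
      rw [interior_Ici] at hx
      have := hc x (le_of_lt hx) (h x (le_of_lt hx)).le
      linarith
  have hfa := h a le_rfl
  have hx : a ≤ a + (f a - c) := by linarith
  have h1 := hanti (mem_Ici.2 le_rfl) (mem_Ici.2 hx) hx
  have h2 := h _ hx
  simp only at h1
  linarith

/-- A positive solution of the damped system `u' = -v`, `v' = -N H v + u ^ p` with damping
`H → ∞` of logarithmically bounded growth decays either fast or slowly. -/
theorem fast_or_slow_decay {H H' u v : ℝ → ℝ} {N p a C A : ℝ} (hN : 0 < N) (hp : 1 < p)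
    (hH : Tendsto H atTop atTop) (hH' : ∀ r ≥ a, HasDerivAt H (H' r) r)
    (hC : ∀ r ≥ a, |H' r| ≤ C * H r)
    (hu : ∀ r ≥ a, HasDerivAt u (-v r) r)
    (hv : ∀ r ≥ a, HasDerivAt v (-(N * H r * v r) + u r ^ p) r)
    (hu0 : ∀ r ≥ a, 0 < u r) (hv0 : ∀ r ≥ a, 0 < v r) (huA : ∀ r ≥ a, u r ≤ A) :
    ∃ b ≥ a, (∀ r ≥ b, 3 * N / 4 * (u r * H r) ≤ v r) ∨
      ∃ K > 0, ∀ r ≥ b, v r * H r ≤ K * u r ^ p := by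
  have hA : 0 < A := (hu0 a le_rfl).trans_le (huA a le_rfl)
  set c₁ := N / (2 * p) with hc₁
  have hc₁0 : 0 < c₁ := by positivity
  have hpc₁ : p * c₁ = N / 2 := by rw [hc₁]; field_simp
  have hc₁N : c₁ < N / 2 := by nlinarith
  set B := A ^ (p - 1) with hB
  obtain ⟨b₀, hb₀⟩ := eventually_atTop.1 ((hH.eventually_ge_atTop 1).and
    ((hH.eventually_ge_atTop (4 * C / N)).and
      (hH.eventually_ge_atTop (4 * (B + 3 * N / 4 * C + 1) / (c₁ * N)))))
  set b := max a b₀ with hb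
  have hba : a ≤ b := le_max_left _ _
  have hHb : ∀ r ≥ b, 1 ≤ H r := fun r hr => (hb₀ r ((le_max_right _ _).trans hr)).1
  have hHC : ∀ r ≥ b, 4 * C ≤ H r * N := fun r hr =>
    (div_le_iff₀ hN).1 (hb₀ r ((le_max_right _ _).trans hr)).2.1
  have hHB : ∀ r ≥ b, 4 * (B + 3 * N / 4 * C + 1) ≤ H r * (c₁ * N) := fun r hr =>
    (div_le_iff₀ (by positivity)).1 (hb₀ r ((le_max_right _ _).trans hr)).2.2
  have hH'b : ∀ r ≥ b, |H' r / H r| ≤ C := fun r hr => by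
    have h0 : 0 < H r := by linarith [hHb r hr]
    rw [abs_div, abs_of_pos h0, div_le_iff₀ h0]
    exact hC r (hba.trans hr)
  set w : ℝ → ℝ := fun r => v r / (u r * H r) with hw
  set w' : ℝ → ℝ := fun r => H r * (w r ^ 2 - N * w r) + u r ^ (p - 1) / H r
    - w r * (H' r / H r) with hw'
  have hw0 : ∀ r ≥ b, 0 < w r := fun r hr =>
    div_pos (hv0 r (hba.trans hr)) (mul_pos (hu0 r (hba.trans hr)) (by linarith [hHb r hr]))
  have hwd : ∀ r ≥ b, HasDerivAt w (w' r) r := by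
    intro r hr
    have hra := hba.trans hr
    have hu1 := hu0 r hra
    have hH1 : 0 < H r := by linarith [hHb r hr]
    refine ((hv r hra).div ((hu r hra).mul (hH' r hra)) (mul_pos hu1 hH1).ne').congr_deriv ?_
    have : u r ^ p = u r ^ (p - 1) * u r := by
      rw [← rpow_add_one hu1.ne']; ring_nf
    simp only [hw', hw, this, Pi.mul_apply]
    field_simp
    ring
  have hwle : ∀ r ≥ b, c₁ ≤ w r → w r ≤ 3 * N / 4 → w' r ≤ -1 := by
    intro r hr h1 h2
    have hra := hba.trans hr
    have hH1 := hHb r hr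
    have e1 : u r ^ (p - 1) / H r ≤ B := by
      have : u r ^ (p - 1) ≤ B := rpow_le_rpow (hu0 r hra).le (huA r hra) (by linarith)
      have h0 : 0 ≤ u r ^ (p - 1) := rpow_nonneg (hu0 r hra).le _
      exact (div_le_self h0 hH1).trans this
    have e2 : - (w r * (H' r / H r)) ≤ 3 * N / 4 * C := by
      have h3 := abs_le.1 (hH'b r hr)
      have hC0 : 0 ≤ C := (abs_nonneg _).trans (hH'b r hr)
      have := hw0 r hr
      nlinarith [mul_le_mul_of_nonneg_left h3.1 this.le, mul_le_mul_of_nonneg_right h2 hC0]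
    have e3 : w r ^ 2 - N * w r ≤ - (c₁ * N / 4) := by nlinarith [hw0 r hr]
    have e4 := mul_le_mul_of_nonneg_left e3 (by linarith : 0 ≤ H r)
    have e5 := hHB r hr
    simp only [hw']
    nlinarith
  by_cases hcase : ∃ r ≥ b, w r ≤ 3 * N / 4
  swap
  · push Not at hcase
    refine ⟨b, hba, Or.inl fun r hr => ?_⟩
    have := hcase r hr
    rw [hw] at this
    exact ((lt_div_iff₀ (mul_pos (hu0 r (hba.trans hr)) (by linarith [hHb r hr]))).1 this).le
  obtain ⟨d, hd, hwd0⟩ := hcase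
  have hle : ∀ r ≥ d, w r ≤ 3 * N / 4 :=
    le_of_hasDerivAt_neg_of_eq (fun x hx => hwd x (hd.trans hx)) hwd0 fun x hx h => by
      linarith [hwle x (hd.trans hx) (by linarith) h.le]
  obtain ⟨e, hed, he⟩ := exists_le_of_hasDerivAt_le_neg_one (c := c₁)
    (fun x hx => hwd x (hd.trans hx))
    fun x hx h => hwle x (hd.trans hx) h (hle x hx)
  have heb : b ≤ e := hd.trans hed
  have hle' : ∀ r ≥ e, w r ≤ c₁ :=
    le_of_hasDerivAt_neg_of_eq (fun x hx => hwd x (heb.trans hx)) he fun x hx h => by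
      linarith [hwle x (heb.trans hx) h.ge (by linarith)]
  refine ⟨e, hba.trans heb, Or.inr ?_⟩
  set q : ℝ → ℝ := fun r => v r * H r * u r ^ (-p) with hq
  set q' : ℝ → ℝ := fun r => H r * (1 - N * q r) + q r * (H' r / H r)
    + p * w r * q r * H r with hq'
  have hqd : ∀ r ≥ e, HasDerivAt q (q' r) r := by
    intro r hr
    have hra := hba.trans (heb.trans hr)
    have hu1 := hu0 r hra
    have hH1 : 0 < H r := by linarith [hHb r (heb.trans hr)]
    refine (((hv r hra).mul (hH' r hra)).mul
      ((hu r hra).rpow_const (p := -p) (Or.inl hu1.ne'))).congr_deriv ?_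
    have h1 : u r ^ (-p - 1) = u r ^ (-p) / u r := rpow_sub_one hu1.ne' _
    have h2 : u r ^ (-p) = (u r ^ p)⁻¹ := rpow_neg hu1.le _
    have h3 : u r ^ p ≠ 0 := (rpow_pos_of_pos hu1 _).ne'
    simp only [hq', hq, hw, h1, h2, Pi.mul_apply]
    field_simp
    ring
  refine ⟨max (q e) (4 / N + 1), lt_max_of_lt_right (by positivity), fun r hr => ?_⟩
  have key : q r ≤ max (q e) (4 / N + 1) := by
    refine le_of_hasDerivAt_neg_of_eq hqd (le_max_left _ _) (fun x hx h => ?_) r hr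
    have hq1 : 4 / N < q x := by
      rw [h]; exact (lt_add_one _).trans_le (le_max_right _ _)
    have hq2 : 4 < q x * N := (div_lt_iff₀ hN).1 hq1
    have hq0 : 0 < q x := lt_trans (by positivity) hq1
    have hxb := heb.trans hx
    have hH1 := hHb x hxb
    have e1 : q x * (H' x / H x) ≤ q x * C :=
      mul_le_mul_of_nonneg_left (abs_le.1 (hH'b x hxb)).2 hq0.le
    have e2 : p * w x * q x * H x ≤ N / 2 * q x * H x := by
      rw [← hpc₁]
      have := hle' x hx
      gcongr
    have e3 : q x * (4 * C) ≤ q x * (H x * N) := mul_le_mul_of_nonneg_left (hHC x hxb) hq0.le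
    have e4 : 0 < (q x * N - 4) * H x := mul_pos (by linarith) (by linarith)
    simp only [hq']
    nlinarith
  have hu1 := hu0 r (hba.trans (heb.trans hr))
  simp only [hq] at key
  rwa [rpow_neg hu1.le, ← div_eq_mul_inv, div_le_iff₀ (rpow_pos_of_pos hu1 _)] at key

theorem exists_tendsto_of_antitoneOn_Ici {f : ℝ → ℝ} {a m : ℝ} (hf : AntitoneOn f (Ici a))
    (hm : ∀ x ≥ a, m ≤ f x) : ∃ L, m ≤ L ∧ Tendsto f atTop (nhds L) := by
  have hg : Antitone fun x => f (max a x) := fun x y hxy =>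
    hf (mem_Ici.2 (le_max_left _ _)) (mem_Ici.2 (le_max_left _ _)) (max_le_max le_rfl hxy)
  have hb : BddBelow (range fun x => f (max a x)) := by
    refine ⟨m, ?_⟩
    rintro _ ⟨x, rfl⟩
    exact hm _ (le_max_left _ _)
  refine ⟨_, le_ciInf fun x => hm _ (le_max_left _ _),
    (tendsto_atTop_ciInf hg hb).congr' ?_⟩
  filter_upwards [eventually_ge_atTop a] with x hx
  rw [max_eq_right hx]

theorem hasDerivAt_of_contDiffOn_Ici {f : ℝ → ℝ} (hf : ContDiffOn ℝ 2 f (Ici 0)) {r : ℝ}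
    (hr : 0 < r) : HasDerivAt f (deriv f r) r ∧ HasDerivAt (deriv f) (deriv (deriv f) r) r := by
  have hf' : ContDiffOn ℝ (1 + 1) f (Ioi 0) := hf.mono Ioi_subset_Ici_self
  rw [contDiffOn_succ_iff_deriv_of_isOpen isOpen_Ioi] at hf'
  have hr' : Ioi (0 : ℝ) ∈ nhds r := Ioi_mem_nhds hr
  exact ⟨(hf'.1.differentiableAt hr').hasDerivAt,
    ((hf'.2.2.differentiableOn one_ne_zero).differentiableAt hr').hasDerivAt⟩

theorem derivWithin_Ici_eq_deriv {f : ℝ → ℝ} {r : ℝ} (hr : 0 < r) :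
    derivWithin f (Ici 0) r = deriv f r :=
  derivWithin_of_mem_nhds (Ici_mem_nhds hr)

theorem continuousOn_derivWithin_Ici {f : ℝ → ℝ} (hf : ContDiffOn ℝ 2 f (Ici 0)) :
    ContinuousOn (derivWithin f (Ici 0)) (Ici 0) :=
  hf.continuousOn_derivWithin (uniqueDiffOn_Ici 0) (by norm_num)

/-- Divergence form of the radial operator. -/
theorem hasDerivAt_pow_mul_deriv {ψ u : ℝ → ℝ} (hψ : ContDiffOn ℝ 2 ψ (Ici 0))
    (hu : ContDiffOn ℝ 2 u (Ici 0)) (k : ℕ) {r : ℝ} (hr : 0 < r) (hψr : 0 < ψ r) :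
    HasDerivAt (fun s => ψ s ^ (k + 1) * deriv u s)
      (ψ r ^ (k + 1) * (deriv (deriv u) r + (k + 1) * (deriv ψ r / ψ r) * deriv u r)) r := by
  refine (((hasDerivAt_of_contDiffOn_Ici hψ hr).1.pow (k + 1)).mul
    (hasDerivAt_of_contDiffOn_Ici hu hr).2).congr_deriv ?_
  simp only [Pi.pow_apply, Nat.add_sub_cancel]
  push_cast
  field_simp
  ring

theorem deriv_neg_of_radial {ψ u : ℝ → ℝ} (hψ : ContDiffOn ℝ 2 ψ (Ici 0)) (hψ0 : ψ 0 = 0)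
    (hψpos : ∀ r > 0, 0 < ψ r) (hu : ContDiffOn ℝ 2 u (Ici 0)) (k : ℕ)
    (h : ∀ r > 0, deriv (deriv u) r + (k + 1) * (deriv ψ r / ψ r) * deriv u r < 0) :
    ∀ r > 0, deriv u r < 0 := by
  intro r hr
  have hanti : StrictAntiOn (fun s => ψ s ^ (k + 1) * derivWithin u (Ici 0) s) (Ici 0) := by
    refine strictAntiOn_of_deriv_neg (convex_Ici 0)
      ((hψ.continuousOn.pow _).mul (continuousOn_derivWithin_Ici hu)) fun x hx => ?_
    rw [interior_Ici, mem_Ioi] at hx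
    have heq : (fun s => ψ s ^ (k + 1) * derivWithin u (Ici 0) s) =ᶠ[nhds x]
        fun s => ψ s ^ (k + 1) * deriv u s := by
      filter_upwards [Ioi_mem_nhds hx] with s hs
      rw [derivWithin_Ici_eq_deriv hs]
    rw [heq.deriv_eq, (hasDerivAt_pow_mul_deriv hψ hu k hx (hψpos x hx)).deriv]
    exact mul_neg_of_pos_of_neg (pow_pos (hψpos x hx) _) (h x hx)
  have := hanti (mem_Ici.2 le_rfl) (mem_Ici.2 hr.le) hr
  simp only [hψ0, derivWithin_Ici_eq_deriv hr, ne_eq, Nat.add_eq_zero_iff, one_ne_zero, and_false,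
    not_false_eq_true, zero_pow, zero_mul] at this
  exact neg_of_mul_neg_right this (pow_pos (hψpos r hr) _).le

/-- Fast decay of the logarithmic derivative forces finite energy. -/
theorem energy_integrableOn_of_fast_decay {ψ u : ℝ → ℝ} {p a A : ℝ} {k : ℕ} (hk : 1 ≤ k)
    (hp : 1 < p) (ha : 0 < a)
    (hψ : ContDiffOn ℝ 2 ψ (Ici 0)) (hψpos : ∀ r > 0, 0 < ψ r) (hu : ContDiffOn ℝ 2 u (Ici 0))
    (hode : ∀ r > 0, deriv (deriv u) r + (k + 1) * (deriv ψ r / ψ r) * deriv u r = -u r ^ p)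
    (hu0 : ∀ r ≥ 0, 0 < u r) (huA : ∀ r ≥ 0, u r ≤ A) (hu' : ∀ r > 0, deriv u r < 0)
    (hH : ∀ r ≥ a, 1 ≤ deriv ψ r / ψ r)
    (hfast : ∀ r ≥ a, 3 * ((k : ℝ) + 1) / 4 * (u r * (deriv ψ r / ψ r)) ≤ -deriv u r) :
    IntegrableOn (fun r => ((u r) ^ 2 + (deriv u r) ^ 2) * ψ r ^ (k + 1)) (Ioi 0) := by
  rw [← Ioc_union_Ioi_eq_Ioi ha.le]
  refine IntegrableOn.union ?_ ?_
  · have hc : ContinuousOn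
        (fun r => ((u r) ^ 2 + (derivWithin u (Ici 0) r) ^ 2) * ψ r ^ (k + 1)) (Icc 0 a) :=
      (((hu.continuousOn.pow 2).add ((continuousOn_derivWithin_Ici hu).pow 2)).mul
        (hψ.continuousOn.pow _)).mono Icc_subset_Ici_self
    refine ((hc.integrableOn_Icc).mono_set Ioc_subset_Icc_self).congr_fun (fun r hr => ?_)
      measurableSet_Ioc
    simp only [derivWithin_Ici_eq_deriv hr.1]
  set D := A ^ (p - 1) + 1 with hD
  set T : ℝ → ℝ := fun r => ψ r ^ (k + 1) * deriv u r * (-u r) + D * (u r ^ 2 * ψ r ^ (k + 1))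
    with hT
  set T' : ℝ → ℝ := fun r => ψ r ^ (k + 1) * (u r ^ p * u r - deriv u r ^ 2)
    + D * (ψ r ^ (k + 1) * u r *
      (2 * deriv u r + (k + 1) * (deriv ψ r / ψ r) * u r)) with hT'
  have hTd : ∀ r > 0, HasDerivAt T (T' r) r := by
    intro r hr
    have hud := (hasDerivAt_of_contDiffOn_Ici hu hr).1
    have hψd := (hasDerivAt_of_contDiffOn_Ici hψ hr).1
    have hψr := hψpos r hr
    refine (((hasDerivAt_pow_mul_deriv hψ hu k hr hψr).mul hud.neg).add
      (((hud.pow 2).mul (hψd.pow (k + 1))).const_mul D)).congr_deriv ?_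
    rw [hode r hr]
    simp only [hT', Pi.pow_apply, Pi.neg_apply, Nat.add_sub_cancel]
    push_cast
    field_simp
    ring
  have hTle : ∀ r ≥ a, ((u r) ^ 2 + (deriv u r) ^ 2) * ψ r ^ (k + 1) ≤ -T' r := by
    intro r hr
    have hr0 : 0 < r := ha.trans_le hr
    have hur := hu0 r hr0.le
    have e1 : u r ^ p * u r ≤ (D - 1) * u r ^ 2 := by
      have : u r ^ p = u r ^ (p - 1) * u r := by
        rw [← rpow_add_one hur.ne']; ring_nf
      have h2 : u r ^ (p - 1) ≤ D - 1 := by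
        rw [hD, add_sub_cancel_right]
        exact rpow_le_rpow hur.le (huA r hr0.le) (by linarith)
      rw [this]
      nlinarith [sq_nonneg (u r)]
    have hD0 : 0 ≤ D := by
      have : 0 ≤ A ^ (p - 1) := rpow_nonneg (hur.le.trans (huA r hr0.le)) _
      linarith
    have hk' : (1 : ℝ) ≤ k := by exact_mod_cast hk
    have e2 : 2 * deriv u r + (k + 1) * (deriv ψ r / ψ r) * u r ≤ -u r := by
      have h3 := hfast r hr
      have h4 : u r ≤ u r * (deriv ψ r / ψ r) := le_mul_of_one_le_right hur.le (hH r hr)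
      have h5 : 2 * (u r * (deriv ψ r / ψ r)) ≤ ((k : ℝ) + 1) * (u r * (deriv ψ r / ψ r)) :=
        mul_le_mul_of_nonneg_right (by linarith) (hur.le.trans h4)
      nlinarith
    have hw : 0 < ψ r ^ (k + 1) := pow_pos (hψpos r hr0) _
    have e3 : D * u r * (2 * deriv u r + (k + 1) * (deriv ψ r / ψ r) * u r)
        ≤ D * u r * (-u r) := mul_le_mul_of_nonneg_left e2 (mul_nonneg hD0 hur.le)
    have e4 := mul_le_mul_of_nonneg_left (add_le_add e1 e3) hw.le
    simp only [hT']
    nlinarith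
  have hpos : ∀ r ≥ a, 0 ≤ ((u r) ^ 2 + (deriv u r) ^ 2) * ψ r ^ (k + 1) := fun r hr =>
    mul_nonneg (by positivity) (pow_pos (hψpos r (ha.trans_le hr)) _).le
  have hanti : AntitoneOn T (Ici a) := by
    refine antitoneOn_of_hasDerivWithinAt_nonpos (f' := T') (convex_Ici a)
      (fun x hx => (hTd x (ha.trans_le hx)).continuousAt.continuousWithinAt) ?_ ?_
    · intro x hx
      rw [interior_Ici] at hx
      exact (hTd x (ha.trans hx)).hasDerivWithinAt
    · intro x hx
      rw [interior_Ici] at hx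
      linarith [hTle x (le_of_lt hx), hpos x (le_of_lt hx)]
  have hT0 : ∀ x ≥ a, 0 ≤ T x := by
    intro x hx
    have hx0 := ha.trans_le hx
    have h1 := hu0 x hx0.le
    have h2 := (pow_pos (hψpos x hx0) (k + 1)).le
    have h3 : 0 ≤ A ^ (p - 1) := rpow_nonneg (h1.le.trans (huA x hx0.le)) _
    exact add_nonneg (mul_nonneg_of_nonpos_of_nonpos
      (mul_nonpos_of_nonneg_of_nonpos h2 (hu' x hx0).le) (by linarith))
      (mul_nonneg (by linarith) (mul_nonneg (sq_nonneg _) h2))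
  obtain ⟨L, -, hL⟩ := exists_tendsto_of_antitoneOn_Ici hanti hT0
  have hint := integrableOn_Ioi_deriv_of_nonpos' (fun x hx => hTd x (ha.trans_le hx))
    (fun x hx => by linarith [hTle x (le_of_lt hx), hpos x (le_of_lt hx)]) hL
  refine hint.neg.mono' ?_ ?_
  · refine ContinuousOn.aestronglyMeasurable (fun x hx => ContinuousAt.continuousWithinAt ?_)
      measurableSet_Ioi
    have hx0 : 0 < x := ha.trans hx
    have h1 := hasDerivAt_of_contDiffOn_Ici hu hx0
    exact ((h1.1.continuousAt.pow 2).add (h1.2.continuousAt.pow 2)).mul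
      ((hasDerivAt_of_contDiffOn_Ici hψ hx0).1.continuousAt.pow _)
  · filter_upwards [ae_restrict_mem measurableSet_Ioi] with x hx
    rw [norm_of_nonneg (hpos x (le_of_lt hx))]
    exact hTle x (le_of_lt hx)

/-- Slow decay with integrable `1 / H` keeps the solution away from zero. -/
theorem exists_pos_le_of_slow_decay {H u v : ℝ → ℝ} {p a K : ℝ} (hp : 1 < p) (hK : 0 < K)
    (hH : ∀ r ≥ a, 0 < H r) (hu : ∀ r ≥ a, HasDerivAt u (-v r) r) (hu0 : ∀ r ≥ a, 0 < u r)
    (hv : ∀ r ≥ a, v r * H r ≤ K * u r ^ p)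
    (hint : IntegrableOn (fun r => (H r)⁻¹) (Ioi a)) : ∃ m > 0, ∀ r ≥ a, m ≤ u r := by
  set J := ∫ r in Ioi a, (H r)⁻¹ with hJ
  set M := u a ^ (1 - p) + (p - 1) * K * J with hM
  have hJ0 : 0 ≤ J := setIntegral_nonneg measurableSet_Ioi fun r hr =>
    (inv_pos.2 (hH r (le_of_lt hr))).le
  have hM0 : 0 < M := add_pos_of_pos_of_nonneg (rpow_pos_of_pos (hu0 a le_rfl) _)
    (mul_nonneg (mul_nonneg (by linarith) hK.le) hJ0)
  refine ⟨M ^ (1 - p)⁻¹, rpow_pos_of_pos hM0 _, fun r hr => ?_⟩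
  have hd : ∀ x ≥ a, HasDerivAt (fun s => u s ^ (1 - p)) (-v x * (1 - p) * u x ^ (1 - p - 1)) x :=
    fun x hx => (hu x hx).rpow_const (Or.inl (hu0 x hx).ne')
  have hintr : IntegrableOn (fun r => (H r)⁻¹) (Icc a r) := by
    rw [integrableOn_Icc_iff_integrableOn_Ioc]
    exact hint.mono_set Ioc_subset_Ioi_self
  have h1 := intervalIntegral.sub_le_integral_of_hasDeriv_right_of_le hr
    (fun x hx => (hd x hx.1).continuousAt.continuousWithinAt)
    (fun x hx => (hd x hx.1.le).hasDerivWithinAt) (hintr.const_mul ((p - 1) * K))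
    fun x hx => by
      have hx := hx.1.le
      have h2 : u x ^ (1 - p - 1) = (u x ^ p)⁻¹ := by
        rw [← rpow_neg (hu0 x hx).le]; ring_nf
      have h3 := rpow_pos_of_pos (hu0 x hx) p
      have h4 : v x * (u x ^ p)⁻¹ ≤ K * (H x)⁻¹ := by
        rw [← div_eq_mul_inv, ← div_eq_mul_inv, div_le_div_iff₀ h3 (hH x hx)]
        exact hv x hx
      rw [h2]
      nlinarith
  have h2 : ∫ x in a..r, (p - 1) * K * (H x)⁻¹ ≤ (p - 1) * K * J := by
    rw [intervalIntegral.integral_const_mul, intervalIntegral.integral_of_le hr]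
    refine mul_le_mul_of_nonneg_left ?_ (mul_nonneg (by linarith) hK.le)
    refine setIntegral_mono_set hint ?_ Ioc_subset_Ioi_self.eventuallyLE
    filter_upwards [ae_restrict_mem measurableSet_Ioi] with x hx
    exact (inv_pos.2 (hH x (le_of_lt hx))).le
  have h3 : u r ^ (1 - p) ≤ M := by
    linarith
  have h4 : M ^ (1 - p)⁻¹ ≤ (u r ^ (1 - p)) ^ (1 - p)⁻¹ :=
    rpow_le_rpow_of_nonpos (rpow_pos_of_pos (hu0 r hr) _) h3 (inv_nonpos.2 (by linarith))
  rwa [← rpow_mul (hu0 r hr).le, mul_inv_cancel₀ (by linarith), rpow_one] at h4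

theorem not_integrableOn_Ioi_of_tendsto_pos {f : ℝ → ℝ} {a l : ℝ} (hl : 0 < l)
    (hf : Tendsto f atTop (nhds l)) : ¬ IntegrableOn f (Ioi a) := by
  intro h
  obtain ⟨b, hb⟩ := eventually_atTop.1 (hf.eventually_const_le (half_lt_self hl))
  have h1 : IntegrableOn (fun _ : ℝ => l / 2) (Ioi (max a b)) := by
    refine (h.mono_set (Ioi_subset_Ioi (le_max_left a b))).mono' aestronglyMeasurable_const ?_
    filter_upwards [ae_restrict_mem measurableSet_Ioi] with x hx
    rw [norm_of_nonneg (by linarith)]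
    exact hb x ((le_max_right a b).trans (le_of_lt hx))
  rw [integrableOn_const_iff] at h1
  rcases h1 with h1 | h1
  · simp [hl.ne'] at h1
  · simp at h1

/-- Positive radial solutions of infinite energy converge to a strictly positive
limit when ψ/ψ' is integrable at infinity (subcritical case). -/
theorem statement7 (n : ℕ) (hn : 3 ≤ n) (p : ℝ) (hp : 1 < p)
    (hsub : p < ((n : ℝ) + 2) / ((n : ℝ) - 2)) (ψ : ℝ → ℝ)
    (h1 : H1 ψ) (h2 : H2 ψ)
    (hl : (∃ l : ℝ, 0 < l ∧ Tendsto (fun r => deriv ψ r / ψ r) atTop (nhds l)) ∨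
          (Tendsto (fun r => deriv ψ r / ψ r) atTop atTop ∧ LogDerivBounded ψ))
    (u : ℝ → ℝ) (α : ℝ) (hu : IsRadialSolution n p ψ u α)
    (hupos : ∀ r ≥ (0:ℝ), 0 < u r) (huH1 : ¬ InEnergySpace n ψ u)
    (hint : IntegrableOn (fun s => ψ s / deriv ψ s) (Ioi 0)) :
    ∃ L : ℝ, 0 < L ∧ Tendsto u atTop (nhds L) := by
  obtain ⟨k, rfl⟩ : ∃ k, n = k + 2 := ⟨n - 2, by omega⟩
  have hk : 1 ≤ k := by omega
  obtain ⟨hψ, hψ0, -, -, hψpos⟩ := h1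
  obtain ⟨huC, hu0α, -, hode⟩ := hu
  have hcast : ((k + 2 : ℕ) : ℝ) - 1 = k + 1 := by push_cast; ring
  rw [hcast] at hode
  have hode' : ∀ r > 0,
      deriv (deriv u) r + (k + 1) * (deriv ψ r / ψ r) * deriv u r = -u r ^ p := by
    intro r hr
    have hur := hupos r hr.le
    have h3 := hode r hr
    rw [abs_of_pos hur, ← rpow_add_one hur.ne', sub_add_cancel] at h3
    linarith
  have hu' : ∀ r > 0, deriv u r < 0 :=
    deriv_neg_of_radial hψ hψ0 hψpos huC k fun r hr => by
      rw [hode' r hr]; exact neg_neg_of_pos (rpow_pos_of_pos (hupos r hr.le) _)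
  have hanti : AntitoneOn u (Ici 0) := by
    refine antitoneOn_of_deriv_nonpos (convex_Ici 0) huC.continuousOn ?_ ?_
    · intro x hx
      rw [interior_Ici] at hx
      exact (hasDerivAt_of_contDiffOn_Ici huC hx).1.differentiableAt.differentiableWithinAt
    · intro x hx
      rw [interior_Ici] at hx
      exact (hu' x hx).le
  have huA : ∀ r ≥ 0, u r ≤ u 0 := fun r hr => hanti (mem_Ici.2 le_rfl) hr hr
  rcases hl with ⟨l, hl0, hl⟩ | ⟨hH, C, hC⟩
  · refine absurd hint (not_integrableOn_Ioi_of_tendsto_pos (inv_pos.2 hl0) ?_)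
    simpa using hl.inv₀ hl0.ne'
  obtain ⟨a₀, ha₀⟩ := eventually_atTop.1 (hC.and (hH.eventually_ge_atTop 1))
  set a := max a₀ 1 with ha
  have ha0 : 0 < a := lt_max_of_lt_right one_pos
  have hH1 : ∀ r ≥ a, 1 ≤ deriv ψ r / ψ r := fun r hr => (ha₀ r ((le_max_left _ _).trans hr)).2
  have hHd : ∀ r ≥ a, HasDerivAt (fun s => deriv ψ s / ψ s)
      (deriv (fun s => deriv ψ s / ψ s) r) r := by
    intro r hr
    have h3 := hasDerivAt_of_contDiffOn_Ici hψ (ha0.trans_le hr)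
    exact (h3.2.differentiableAt.div h3.1.differentiableAt
      (hψpos r (ha0.trans_le hr)).ne').hasDerivAt
  have hHC : ∀ r ≥ a, |deriv (fun s => deriv ψ s / ψ s) r| ≤ C * (deriv ψ r / ψ r) := by
    intro r hr
    have h3 := (ha₀ r ((le_max_left _ _).trans hr)).1
    have h4 : 0 < deriv ψ r / ψ r := by linarith [hH1 r hr]
    rwa [((hHd r hr).log h4.ne').deriv, abs_div, abs_of_pos h4, div_le_iff₀ h4] at h3
  obtain ⟨b, hab, hb⟩ := fast_or_slow_decay (v := fun r => -deriv u r) (N := (k : ℝ) + 1) (p := p)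
    (A := u 0) (by positivity) hp hH hHd hHC
    (fun r hr => by simpa using (hasDerivAt_of_contDiffOn_Ici huC (ha0.trans_le hr)).1)
    (fun r hr => (hasDerivAt_of_contDiffOn_Ici huC (ha0.trans_le hr)).2.neg.congr_deriv
      (by linarith [hode' r (ha0.trans_le hr)]))
    (fun r hr => hupos r (ha0.le.trans hr))
    (fun r hr => neg_pos.2 (hu' r (ha0.trans_le hr))) fun r hr => huA r (ha0.le.trans hr)
  have hb0 : 0 < b := ha0.trans_le hab
  rcases hb with hb | ⟨K, hK, hb⟩
  · exact absurd (energy_integrableOn_of_fast_decay hk hp hb0 hψ hψpos huC hode' hupos huA hu'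
      (fun r hr => hH1 r (hab.trans hr)) hb) huH1
  · obtain ⟨m, hm, hmu⟩ := exists_pos_le_of_slow_decay hp hK
      (fun r hr => one_pos.trans_le (hH1 r (hab.trans hr)))
      (fun r hr => by simpa using (hasDerivAt_of_contDiffOn_Ici huC (hb0.trans_le hr)).1)
      (fun r hr => hupos r (hb0.le.trans hr)) hb
      (by simpa using hint.mono_set (Ioi_subset_Ioi hb0.le))
    obtain ⟨L, hL, hlim⟩ := exists_tendsto_of_antitoneOn_Ici
      (hanti.mono (Ici_subset_Ici.2 hb0.le)) hmu
    exact ⟨L, hm.trans_le hL, hlim⟩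
end
end

section
/- Let p ≥ (n+2)/(n−2) and let ψ satisfy (H1)–(H2); in the critical case p = (n+2)/(n−2) assume furthermore that ψ is three times differentiable near 0 with ψ'''(0) > 0. Assume the function A(r) = (∫₀^r ψ(s)^{n−1} ds)^{(p−1)/(2(p+1))} is convex on [0, ∞). Then every radial solution u with u(0) = α > 0 satisfies u(r) > 0 for all r ≥ 0. In particular, for every r̄ ∈ (0, ∞) there is no nontrivial C² function v : [0, r̄] → ℝ with v'(0) = 0 and v(r̄) = 0 satisfying v''(r) + (n−1)(ψ'(r)/ψ(r)) v'(r) + |v(r)|^{p−1} v(r) = 0 for 0 < r < r̄. -/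
open Real MeasureTheory Filter Set Asymptotics

noncomputable section

/-- A(r) = (∫₀^r ψ(s)^{n-1} ds)^{(p-1)/(2(p+1))}. -/
def Afun (n : ℕ) (p : ℝ) (ψ : ℝ → ℝ) : ℝ → ℝ := fun r =>
  (∫ s in Ioc (0:ℝ) r, ψ s ^ (n - 1)) ^ ((p - 1) / (2 * (p + 1)))

/-- Lower bound for `Φ Φ''` on `(0, ∞)` when the power `Φ ^ k` is convex. -/
lemma one_sub_mul_sq_le_of_convexOn_rpow {Φ V V' : ℝ → ℝ} {k : ℝ} (hk : 0 < k)
    (hΦpos : ∀ r > 0, 0 < Φ r) (hΦ : ∀ r > 0, HasDerivAt Φ (V r) r)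
    (hV : ∀ r > 0, HasDerivAt V (V' r) r)
    (hconv : ConvexOn ℝ (Ioi 0) fun r => Φ r ^ k) {r : ℝ} (hr : 0 < r) :
    (1 - k) * V r ^ 2 ≤ Φ r * V' r := by
  have hd1 : ∀ x > 0, HasDerivAt (fun r => Φ r ^ k) (V x * k * Φ x ^ (k - 1)) x :=
    fun x hx => (hΦ x hx).rpow_const (Or.inl (hΦpos x hx).ne')
  have hd2 : HasDerivAt (fun x => V x * k * Φ x ^ (k - 1))
      (V' r * k * Φ r ^ (k - 1) + V r * k * (V r * (k - 1) * Φ r ^ (k - 1 - 1))) r :=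
    ((hV r hr).mul_const k).mul ((hΦ r hr).rpow_const (Or.inl (hΦpos r hr).ne'))
  have hmono : MonotoneOn (fun x => V x * k * Φ x ^ (k - 1)) (Ioi 0) := by
    have h := hconv.monotoneOn_deriv fun x hx => (hd1 x hx).differentiableAt
    intro x hx y hy hxy
    have := h hx hy hxy
    rwa [(hd1 x hx).deriv, (hd1 y hy).deriv] at this
  have hnn : 0 ≤ V' r * k * Φ r ^ (k - 1) + V r * k * (V r * (k - 1) * Φ r ^ (k - 1 - 1)) := by
    rw [← hd2.deriv, ← derivWithin_of_mem_nhds (Ioi_mem_nhds hr)]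
    exact hmono.derivWithin_nonneg
  have hsplit : Φ r ^ (k - 1) = Φ r ^ (k - 1 - 1) * Φ r := by
    rw [← rpow_add_one (hΦpos r hr).ne']
    ring_nf
  have hpos : 0 < k * Φ r ^ (k - 1 - 1) := mul_pos hk (rpow_pos_of_pos (hΦpos r hr) _)
  rw [hsplit] at hnn
  have : 0 ≤ (k * Φ r ^ (k - 1 - 1)) * (Φ r * V' r - (1 - k) * V r ^ 2) := by
    linarith
  linarith [nonneg_of_mul_nonneg_right this hpos]

/-- Pohozaev-type uniqueness: a solution of `v'' + (V'/V) v' + |v|^{p-1} v = 0` on `(0, R)` with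
`v R = 0` vanishes identically, provided that `Φ V' ≥ (p+3)/(2(p+1)) V²` for the primitive `Φ`
of `V` vanishing at the origin. -/
lemma eqOn_zero_of_pohozaev {p R : ℝ} (hp : 1 < p) (hR : 0 < R) {Φ V V' v w w' : ℝ → ℝ}
    (hΦc : ContinuousOn Φ (Icc 0 R)) (hVc : ContinuousOn V (Icc 0 R))
    (hvc : ContinuousOn v (Icc 0 R)) (hwc : ContinuousOn w (Icc 0 R))
    (hΦ0 : Φ 0 = 0) (hV0 : V 0 = 0) (hΦR : 0 < Φ R) (hVpos : ∀ r ∈ Ioc 0 R, 0 < V r)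
    (hΦ : ∀ r ∈ Ioo 0 R, HasDerivAt Φ (V r) r) (hV : ∀ r ∈ Ioo 0 R, HasDerivAt V (V' r) r)
    (hv : ∀ r ∈ Ioo 0 R, HasDerivAt v (w r) r) (hw : ∀ r ∈ Ioo 0 R, HasDerivAt w (w' r) r)
    (hV' : ∀ r ∈ Ioo 0 R, 0 ≤ V' r)
    (hineq : ∀ r ∈ Ioo 0 R, (p + 3) / (2 * (p + 1)) * V r ^ 2 ≤ Φ r * V' r)
    (hode : ∀ r ∈ Ioo 0 R, w' r + V' r / V r * w r + |v r| ^ (p - 1) * v r = 0)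
    (hvR : v R = 0) : ∀ r ∈ Icc 0 R, v r = 0 := by
  have hp1 : 0 < p + 1 := by linarith
  have hmem : ∀ r ∈ Ioo 0 R, r ∈ Ioc 0 R := fun r hr => ⟨hr.1, hr.2.le⟩
  set F : ℝ → ℝ := fun r => w r ^ 2 / 2 + |v r| ^ (p + 1) / (p + 1) with hF
  have hFc : ContinuousOn F (Icc 0 R) :=
    ((hwc.pow 2).div_const 2).add
      ((hvc.abs.rpow_const fun _ _ => Or.inr hp1.le).div_const (p + 1))
  have hFd : ∀ r ∈ Ioo 0 R, HasDerivAt F (-(V' r / V r) * w r ^ 2) r := by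
    intro r hr
    have h1 := ((hw r hr).pow 2).div_const 2
    have h2 := ((hasDerivAt_abs_rpow (v r) (p := p + 1) (by linarith)).comp r
      (hv r hr)).div_const (p + 1)
    refine (h1.add h2).congr_deriv ?_
    have e : w' r = -(V' r / V r * w r) - |v r| ^ (p - 1) * v r := by
      linarith [hode r hr]
    rw [e, show p + 1 - 2 = p - 1 by ring]
    field_simp
    ring
  have habs : ∀ r, |v r| ^ (p + 1) = |v r| ^ (p - 1) * v r ^ 2 := by
    intro r
    rw [← sq_abs (v r), ← rpow_natCast, ← rpow_add_of_nonneg (abs_nonneg _) (by linarith)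
      (by norm_num)]
    norm_num
    ring_nf
  have hFR : F R = w R ^ 2 / 2 := by
    simp [hF, hvR, zero_rpow hp1.ne']
  have hP : AntitoneOn (fun r => Φ r * F r + V r * v r * w r / (p + 1)) (Icc 0 R) := by
    refine antitoneOn_of_hasDerivWithinAt_nonpos (convex_Icc 0 R)
      ((hΦc.mul hFc).add (((hVc.mul hvc).mul hwc).div_const _))
      (f' := fun r => ((p + 3) / (2 * (p + 1)) * V r ^ 2 - Φ r * V' r) * (w r ^ 2 / V r)) ?_ ?_
    · intro r hr
      rw [interior_Icc] at hr
      have hVr := hVpos r (hmem r hr)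
      refine HasDerivAt.hasDerivWithinAt (HasDerivAt.congr_deriv
        (((hΦ r hr).mul (hFd r hr)).add
          ((((hV r hr).mul (hv r hr)).mul (hw r hr)).div_const (p + 1))) ?_)
      have e : w' r = -(V' r / V r * w r) - |v r| ^ (p - 1) * v r := by
        linarith [hode r hr]
      simp only [hF, habs, e, Pi.mul_apply]
      field_simp
      ring
    · intro r hr
      rw [interior_Icc] at hr
      exact mul_nonpos_of_nonpos_of_nonneg (sub_nonpos.2 (hineq r hr))
        (div_nonneg (sq_nonneg _) (hVpos r (hmem r hr)).le)
  have hwR : w R ^ 2 = 0 := by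
    have h := hP (left_mem_Icc.2 hR.le) (right_mem_Icc.2 hR.le) hR.le
    simp only [hΦ0, hV0, hFR, hvR, zero_mul, mul_zero, zero_div, add_zero] at h
    nlinarith [sq_nonneg (w R)]
  have hG : MonotoneOn (fun r => V r ^ 2 * F r) (Icc 0 R) := by
    refine monotoneOn_of_hasDerivWithinAt_nonneg (convex_Icc 0 R) ((hVc.pow 2).mul hFc)
      (f' := fun r => 2 * V r * V' r * (|v r| ^ (p + 1) / (p + 1))) ?_ ?_
    · intro r hr
      rw [interior_Icc] at hr
      have hVr := hVpos r (hmem r hr)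
      refine HasDerivAt.hasDerivWithinAt (HasDerivAt.congr_deriv
        (((hV r hr).pow 2).mul (hFd r hr)) ?_)
      simp only [hF, Pi.pow_apply]
      field_simp
      norm_num
      ring
    · intro r hr
      rw [interior_Icc] at hr
      have := hVpos r (hmem r hr)
      have := hV' r hr
      positivity
  have hzero : ∀ r ∈ Ioc 0 R, v r = 0 := by
    intro r hr
    have h := hG ⟨hr.1.le, hr.2⟩ (right_mem_Icc.2 hR.le) hr.2
    simp only [hFR, hwR, zero_div, mul_zero] at h
    have hFle : F r ≤ 0 := nonpos_of_mul_nonpos_right h (pow_pos (hVpos r hr) 2)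
    by_contra hne
    have h3 : 0 < |v r| ^ (p + 1) / (p + 1) := div_pos (rpow_pos_of_pos (abs_pos.2 hne) _) hp1
    have h4 : F r = w r ^ 2 / 2 + |v r| ^ (p + 1) / (p + 1) := rfl
    linarith [sq_nonneg (w r)]
  have hEq : EqOn v (fun _ => 0) (Icc 0 R) :=
    EqOn.of_subset_closure (s := Ioc 0 R) hzero hvc continuousOn_const Ioc_subset_Icc_self
      (closure_Ioc hR.ne).ge
  exact hEq

/-- In the supercritical case, if A is convex then radial solutions with positive
initial value are everywhere positive, and the Dirichlet problem on geodesic balls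
has no nontrivial radial solutions. -/
theorem statement9 (n : ℕ) (hn : 3 ≤ n) (p : ℝ) (hp : 1 < p)
    (hsuper : ((n : ℝ) + 2) / ((n : ℝ) - 2) ≤ p) (ψ : ℝ → ℝ)
    (h1 : H1 ψ) (h2 : H2 ψ)
    (hcrit : p = ((n : ℝ) + 2) / ((n : ℝ) - 2) →
      (∃ ε > (0:ℝ), ContDiffOn ℝ 3 ψ (Ico 0 ε)) ∧ 0 < deriv^[3] ψ 0)
    (hA : ConvexOn ℝ (Ici 0) (Afun n p ψ)) :
    (∀ (α : ℝ) (u : ℝ → ℝ), 0 < α → IsRadialSolution n p ψ u α →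
      ∀ r ≥ (0:ℝ), 0 < u r) ∧
    ∀ rb : ℝ, 0 < rb → ∀ v : ℝ → ℝ, ContDiffOn ℝ 2 v (Icc 0 rb) →
      deriv v 0 = 0 → v rb = 0 →
      (∀ r : ℝ, 0 < r → r < rb →
        deriv (deriv v) r + ((n : ℝ) - 1) * (deriv ψ r / ψ r) * deriv v r
          + |v r| ^ (p - 1) * v r = 0) →
      ∀ r ∈ Icc (0:ℝ) rb, v r = 0 := by
  obtain ⟨hψ, hψ0, -, -, hψpos⟩ := h1
  have hψc : ContinuousOn ψ (Ici 0) := hψ.continuousOn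
  have hψd : ∀ r > 0, HasDerivAt ψ (deriv ψ r) r := fun r hr =>
    ((hψ.contDiffAt (Ici_mem_nhds hr)).differentiableAt (by norm_num)).hasDerivAt
  have hVc : ContinuousOn (fun s => ψ s ^ (n - 1)) (Ici 0) := hψc.pow _
  have hint : ∀ r ≥ 0, IntervalIntegrable (fun s => ψ s ^ (n - 1)) volume 0 r := fun r hr =>
    (hVc.mono (by rw [uIcc_of_le hr]; exact Icc_subset_Ici_self)).intervalIntegrable
  have hΦpos : ∀ r > 0, 0 < ∫ s in (0 : ℝ)..r, ψ s ^ (n - 1) := fun r hr =>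
    intervalIntegral.intervalIntegral_pos_of_pos_on (hint r hr.le)
      (fun s hs => pow_pos (hψpos s hs.1) _) hr
  have hΦd : ∀ r > 0, HasDerivAt (fun x => ∫ s in (0 : ℝ)..x, ψ s ^ (n - 1)) (ψ r ^ (n - 1)) r :=
    fun r hr => intervalIntegral.integral_hasDerivAt_right (hint r hr.le)
      ((hVc.mono Ioi_subset_Ici_self).stronglyMeasurableAtFilter isOpen_Ioi r hr)
      (hVc.continuousAt (Ici_mem_nhds hr))
  have hVd : ∀ r > 0, HasDerivAt (fun s => ψ s ^ (n - 1))
      (((n - 1 : ℕ) : ℝ) * ψ r ^ (n - 1 - 1) * deriv ψ r) r := fun r hr => (hψd r hr).pow (n - 1)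
  have hconv : ConvexOn ℝ (Ioi 0) fun r =>
      (∫ s in (0 : ℝ)..r, ψ s ^ (n - 1)) ^ ((p - 1) / (2 * (p + 1))) := by
    refine (hA.subset Ioi_subset_Ici_self (convex_Ioi 0)).congr fun r hr => ?_
    rw [Afun, intervalIntegral.integral_of_le (le_of_lt hr)]
  have hk : 0 < (p - 1) / (2 * (p + 1)) := div_pos (by linarith) (by linarith)
  have hdirichlet : ∀ rb : ℝ, 0 < rb → ∀ v : ℝ → ℝ, ContDiffOn ℝ 2 v (Icc 0 rb) → v rb = 0 →
      (∀ r : ℝ, 0 < r → r < rb →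
        deriv (deriv v) r + ((n : ℝ) - 1) * (deriv ψ r / ψ r) * deriv v r
          + |v r| ^ (p - 1) * v r = 0) → ∀ r ∈ Icc (0 : ℝ) rb, v r = 0 := by
    intro R hR v hv hvR hode
    have hsub : Icc 0 R ⊆ Ici (0 : ℝ) := Icc_subset_Ici_self
    have hw : ∀ r ∈ Ioo 0 R, derivWithin v (Icc 0 R) r = deriv v r := fun r hr =>
      derivWithin_of_mem_nhds (Icc_mem_nhds hr.1 hr.2)
    have hvat : ∀ r ∈ Ioo 0 R, ContDiffAt ℝ 2 v r := fun r hr =>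
      hv.contDiffAt (Icc_mem_nhds hr.1 hr.2)
    refine eqOn_zero_of_pohozaev hp hR (w := derivWithin v (Icc 0 R)) (w' := deriv (deriv v))
      (Φ := fun x => ∫ s in (0 : ℝ)..x, ψ s ^ (n - 1)) (V := fun s => ψ s ^ (n - 1))
      ?_ (hVc.mono hsub) hv.continuousOn
      (hv.continuousOn_derivWithin (uniqueDiffOn_Icc hR) (by norm_num)) (by simp)
      (by simp only [hψ0]; exact zero_pow (by omega)) (hΦpos R hR)
      (fun r hr => pow_pos (hψpos r hr.1) _) (fun r hr => hΦd r hr.1) (fun r hr => hVd r hr.1)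
      ?_ ?_ ?_ ?_ ?_ hvR
    · have := intervalIntegral.continuousOn_primitive_interval (μ := volume)
        (f := fun s => ψ s ^ (n - 1)) (a := 0) (b := R)
        (by rw [uIcc_of_le hR.le]; exact (hVc.mono hsub).integrableOn_Icc)
      rwa [uIcc_of_le hR.le] at this
    · intro r hr
      rw [hw r hr]
      exact ((hvat r hr).differentiableAt (by norm_num)).hasDerivAt
    · intro r hr
      have h1 : ContDiffAt ℝ 1 (deriv v) r := (hvat r hr).derivWithin (by norm_num)
      refine (h1.differentiableAt (by norm_num)).hasDerivAt.congr_of_eventuallyEq ?_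
      filter_upwards [Ioo_mem_nhds hr.1 hr.2] with x hx using hw x hx
    · intro r hr
      have := hψpos r hr.1
      have := h2 r hr.1
      positivity
    · intro r hr
      have h := one_sub_mul_sq_le_of_convexOn_rpow hk hΦpos hΦd hVd hconv hr.1
      have e : 1 - (p - 1) / (2 * (p + 1)) = (p + 3) / (2 * (p + 1)) := by
        field_simp
        ring
      rwa [e] at h
    · intro r hr
      have hne := (hψpos r hr.1).ne'
      rw [hw r hr, ← hode r hr.1 hr.2]
      obtain ⟨m, rfl⟩ : ∃ m, n = m + 2 := ⟨n - 2, by omega⟩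
      simp only [show m + 2 - 1 = m + 1 by omega, Nat.add_sub_cancel]
      push_cast
      field_simp
      ring
  refine ⟨?_, fun rb hrb v hv _ hvrb hode => hdirichlet rb hrb v hv hvrb hode⟩
  rintro α u hα ⟨hu, hu0, -, hode⟩ r hr
  by_contra! hneg
  obtain ⟨R, hR, hRz⟩ : (0 : ℝ) ∈ u '' Icc 0 r :=
    intermediate_value_Icc' hr (hu.continuousOn.mono Icc_subset_Ici_self) ⟨hneg, by
      rw [hu0]; exact hα.le⟩
  have hRpos : 0 < R := lt_of_le_of_ne hR.1 (by rintro rfl; linarith)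
  have := hdirichlet R hRpos u (hu.mono Icc_subset_Ici_self) hRz (fun x hx _ => hode x hx) 0
    (left_mem_Icc.2 hRpos.le)
  linarith
end
end

section
/- Assume ψ satisfies (H1)–(H2) and lim_{r→∞} ψ'(r)/ψ(r) = l ∈ (0, +∞]; in case l = +∞ assume additionally that the function [log(ψ'(r)/ψ(r))]' is bounded as r → ∞. Then the function A(r) = (∫₀^r ψ(s)^{n−1} ds)^{(p−1)/(2(p+1))} is eventually convex at +∞, i.e. there exists R > 0 such that A is convex on [R, ∞). -/
open Real MeasureTheory Filter Set Asymptotics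

noncomputable section

/-- A function whose derivative is eventually bounded below by a positive constant is eventually
nonnegative. -/
theorem eventually_nonneg_of_le_hasDerivAt {F F' : ℝ → ℝ} {ε : ℝ} (hε : 0 < ε)
    (h : ∀ᶠ r in atTop, HasDerivAt F (F' r) r ∧ ε ≤ F' r) : ∀ᶠ r in atTop, 0 ≤ F r := by
  obtain ⟨R, hR⟩ := eventually_atTop.1 h
  have key : ∀ r ≥ R, ε * (r - R) ≤ F r - F R := fun r hr =>
    (convex_Ici R).mul_sub_le_image_sub_of_le_deriv
      (fun x hx => (hR x hx).1.continuousAt.continuousWithinAt)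
      (fun x hx => (hR x (interior_subset hx)).1.differentiableAt.differentiableWithinAt)
      (fun x hx => by
        rw [(hR x (interior_subset hx)).1.deriv]
        exact (hR x (interior_subset hx)).2)
      R self_mem_Ici r hr hr
  filter_upwards [eventually_ge_atTop R, eventually_ge_atTop (R - F R / ε)] with r h₁ h₂
  have h₃ := key r h₁
  have h₄ : ε * (-(F R / ε)) ≤ ε * (r - R) := mul_le_mul_of_nonneg_left (by linarith) hε.le
  have h₅ : ε * (-(F R / ε)) = -F R := by field_simp
  linarith

namespace H1

variable {ψ : ℝ → ℝ}

theorem contDiffAt (h : H1 ψ) {r : ℝ} (hr : 0 < r) : ContDiffAt ℝ 2 ψ r :=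
  h.1.contDiffAt (Ici_mem_nhds hr)

theorem hasDerivAt (h : H1 ψ) {r : ℝ} (hr : 0 < r) : HasDerivAt ψ (deriv ψ r) r :=
  ((h.contDiffAt hr).differentiableAt (by norm_num)).hasDerivAt

theorem hasDerivAt_deriv (h : H1 ψ) {r : ℝ} (hr : 0 < r) :
    HasDerivAt (deriv ψ) (deriv (deriv ψ) r) r :=
  (((h.contDiffAt hr).derivWithin (m := 1) (by norm_num)).differentiableAt
    (by norm_num)).hasDerivAt

theorem pos (h : H1 ψ) {r : ℝ} (hr : 0 < r) : 0 < ψ r := h.2.2.2.2 r hr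

theorem le_of_H2 (h : H1 ψ) (h2 : H2 ψ) {a b : ℝ} (ha : 0 ≤ a) (hab : a ≤ b) : ψ a ≤ ψ b := by
  refine monotoneOn_of_deriv_nonneg (convex_Ici 0) h.1.continuousOn (fun x hx => ?_)
    (fun x hx => ?_) ha (ha.trans hab) hab
  · rw [interior_Ici] at hx
    exact (h.hasDerivAt hx).differentiableAt.differentiableWithinAt
  · rw [interior_Ici] at hx
    exact h2 x hx

theorem intervalIntegrable_pow (h : H1 ψ) (m : ℕ) {r : ℝ} (hr : 0 ≤ r) :
    IntervalIntegrable (fun s => ψ s ^ m) volume 0 r := by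
  apply ContinuousOn.intervalIntegrable
  rw [uIcc_of_le hr]
  exact (h.1.continuousOn.mono Icc_subset_Ici_self).pow m

theorem integral_pow_pos (h : H1 ψ) (m : ℕ) {r : ℝ} (hr : 0 < r) :
    0 < ∫ s in Ioc (0 : ℝ) r, ψ s ^ m := by
  rw [← intervalIntegral.integral_of_le hr.le]
  exact intervalIntegral.intervalIntegral_pos_of_pos_on (h.intervalIntegrable_pow m hr.le)
    (fun x hx => pow_pos (h.pos hx.1) m) hr

theorem hasDerivAt_integral_pow (h : H1 ψ) (m : ℕ) {r : ℝ} (hr : 0 < r) :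
    HasDerivAt (fun r => ∫ s in Ioc (0 : ℝ) r, ψ s ^ m) (ψ r ^ m) r := by
  have hd : HasDerivAt (fun r => ∫ s in (0 : ℝ)..r, ψ s ^ m) (ψ r ^ m) r := by
    refine intervalIntegral.integral_hasDerivAt_right (h.intervalIntegrable_pow m hr.le) ?_
      ((h.hasDerivAt hr).continuousAt.pow m)
    exact ContinuousOn.stronglyMeasurableAtFilter isOpen_Ioi
      ((h.1.continuousOn.mono Ioi_subset_Ici_self).pow m) r hr
  refine hd.congr_of_eventuallyEq ?_
  filter_upwards [Ioi_mem_nhds hr] with x hx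
  exact (intervalIntegral.integral_of_le (le_of_lt hx)).symm

/-- If `g` is an eventually positive lower bound for `ψ' / ψ` whose growth is controlled, then
`c ψ ^ m` is eventually bounded by `m (ψ' / ψ) ∫ ψ ^ m`. -/
theorem eventually_mul_pow_le (h : H1 ψ) (h2 : H2 ψ) {m : ℕ} (hm : 0 < m) {c d : ℝ}
    (hd : d < 1) {g g' : ℝ → ℝ}
    (hg : ∀ᶠ r in atTop, HasDerivAt g (g' r) r ∧ 0 < g r ∧ g r ≤ deriv ψ r / ψ r ∧
      c * (deriv ψ r / ψ r) / g r - c * g' r / (m * g r ^ 2) ≤ d) :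
    ∀ᶠ r in atTop, c * ψ r ^ m ≤ m * (deriv ψ r / ψ r) * ∫ s in Ioc (0 : ℝ) r, ψ s ^ m := by
  have hm' : (0 : ℝ) < m := by exact_mod_cast hm
  have hε : 0 < ψ 1 ^ m * (1 - d) := mul_pos (pow_pos (h.pos one_pos) m) (by linarith)
  have hF : ∀ᶠ r in atTop, 0 ≤ (∫ s in Ioc (0 : ℝ) r, ψ s ^ m) - c / m * (ψ r ^ m / g r) := by
    refine eventually_nonneg_of_le_hasDerivAt
      (F' := fun r => ψ r ^ m - c / m *
        ((m * ψ r ^ (m - 1) * deriv ψ r * g r - ψ r ^ m * g' r) / g r ^ 2)) hε ?_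
    filter_upwards [hg, eventually_ge_atTop 1] with r ⟨hgd, hg0, _, hgr⟩ hr
    have hr0 : 0 < r := one_pos.trans_le hr
    have hψ := h.pos hr0
    refine ⟨(h.hasDerivAt_integral_pow m hr0).sub
      ((((h.hasDerivAt hr0).fun_pow m).fun_div hgd hg0.ne').const_mul _), ?_⟩
    have heq : ψ r ^ m - c / m *
        ((m * ψ r ^ (m - 1) * deriv ψ r * g r - ψ r ^ m * g' r) / g r ^ 2) =
        ψ r ^ m * (1 - (c * (deriv ψ r / ψ r) / g r - c * g' r / (m * g r ^ 2))) := by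
      obtain ⟨k, rfl⟩ := Nat.exists_eq_succ_of_ne_zero hm.ne'
      simp only [Nat.succ_eq_add_one, Nat.add_sub_cancel, pow_succ (ψ r)] at hm' ⊢
      field_simp
    rw [heq]
    exact mul_le_mul (pow_le_pow_left₀ (h.pos one_pos).le (h.le_of_H2 h2 zero_le_one hr) m)
      (by linarith) (by linarith) (pow_pos hψ m).le
  filter_upwards [hF, hg, eventually_gt_atTop 0] with r hFr ⟨_, hg0, hgh, _⟩ hr0
  have hI := h.integral_pow_pos m hr0
  calc c * ψ r ^ m = m * g r * (c / m * (ψ r ^ m / g r)) := by field_simp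
    _ ≤ m * g r * ∫ s in Ioc (0 : ℝ) r, ψ s ^ m :=
      mul_le_mul_of_nonneg_left (by linarith) (by positivity)
    _ ≤ _ := by gcongr

theorem eventually_mul_pow_le_of_tendsto_nhds (h : H1 ψ) (h2 : H2 ψ) {m : ℕ} (hm : 0 < m)
    {c l : ℝ} (hc0 : 0 < c) (hc : c < 1) (hl : 0 < l)
    (ht : Tendsto (fun r => deriv ψ r / ψ r) atTop (nhds l)) :
    ∀ᶠ r in atTop, c * ψ r ^ m ≤ m * (deriv ψ r / ψ r) * ∫ s in Ioc (0 : ℝ) r, ψ s ^ m := by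
  have hk : 0 < l * (1 - (1 - c) / 4) := mul_pos hl (by linarith)
  refine h.eventually_mul_pow_le h2 hm (d := (1 + c) / 2) (by linarith)
    (g := fun _ => l * (1 - (1 - c) / 4)) (g' := fun _ => 0) ?_
  filter_upwards [ht.eventually_const_le (u := l * (1 - (1 - c) / 4)) (by nlinarith),
    ht.eventually_le_const (u := l * (1 + (1 - c) / 4)) (by nlinarith)] with r h₁ h₂
  refine ⟨hasDerivAt_const _ _, hk, h₁, ?_⟩
  rw [mul_zero, zero_div, sub_zero, div_le_iff₀ hk]
  calc c * (deriv ψ r / ψ r) ≤ c * (l * (1 + (1 - c) / 4)) := by gcongr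
    _ ≤ _ := by nlinarith [mul_nonneg hl.le (sq_nonneg (1 - c))]

theorem eventually_mul_pow_le_of_tendsto_atTop (h : H1 ψ) (h2 : H2 ψ) {m : ℕ} (hm : 0 < m)
    {c : ℝ} (hc0 : 0 < c) (hc : c < 1)
    (ht : Tendsto (fun r => deriv ψ r / ψ r) atTop atTop) (hb : LogDerivBounded ψ) :
    ∀ᶠ r in atTop, c * ψ r ^ m ≤ m * (deriv ψ r / ψ r) * ∫ s in Ioc (0 : ℝ) r, ψ s ^ m := by
  obtain ⟨C, hC⟩ := hb
  refine h.eventually_mul_pow_le h2 hm (d := (1 + c) / 2) (by linarith)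
    (g := fun r => deriv ψ r / ψ r) (g' := deriv fun r => deriv ψ r / ψ r) ?_
  filter_upwards [hC, ht.eventually_gt_atTop 0, ht.eventually_ge_atTop (2 * C / (1 - c)),
    eventually_gt_atTop 0] with r hCr hpos hge hr
  have hdiff : DifferentiableAt ℝ (fun r => deriv ψ r / ψ r) r :=
    ((h.hasDerivAt_deriv hr).fun_div (h.hasDerivAt hr) (h.pos hr).ne').differentiableAt
  refine ⟨hdiff.hasDerivAt, hpos, le_rfl, ?_⟩
  rw [(hdiff.hasDerivAt.log hpos.ne').deriv] at hCr
  rw [div_le_iff₀ (by linarith)] at hge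
  generalize deriv (fun r => deriv ψ r / ψ r) r = q at *
  generalize deriv ψ r / ψ r = x at *
  have hm' : (1 : ℝ) ≤ m := by exact_mod_cast hm
  have hC0 : 0 ≤ C := (abs_nonneg _).trans hCr
  have h₁ : -C ≤ q / x := neg_le_of_abs_le hCr
  have h₂ : c * C / (m * x) ≤ (1 - c) / 2 := by
    rw [div_le_iff₀ (by positivity)]
    have h₃ : c * C ≤ C := mul_le_of_le_one_left hC0 hc.le
    have h₄ : x ≤ m * x := le_mul_of_one_le_left hpos.le hm'
    nlinarith
  have h₅ : c * x / x - c * q / (m * x ^ 2) = c + c * (-(q / x)) / (m * x) := by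
    field_simp
    ring
  have h₆ : c * (-(q / x)) / (m * x) ≤ c * C / (m * x) := by
    gcongr
    linarith
  rw [h₅]
  linarith

/-- Powers of `∫ ψ ^ m` are convex wherever `(1 - α) ψ ^ m ≤ m (ψ' / ψ) ∫ ψ ^ m`. -/
theorem convexOn_integral_pow_rpow (h : H1 ψ) {m : ℕ} (hm : 0 < m) {α R : ℝ} (hα : 0 ≤ α)
    (hR : 0 < R)
    (hle : ∀ r ≥ R, (1 - α) * ψ r ^ m ≤
      m * (deriv ψ r / ψ r) * ∫ s in Ioc (0 : ℝ) r, ψ s ^ m) :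
    ConvexOn ℝ (Ici R) fun r => (∫ s in Ioc (0 : ℝ) r, ψ s ^ m) ^ α := by
  set I : ℝ → ℝ := fun r => ∫ s in Ioc (0 : ℝ) r, ψ s ^ m with hI
  have hI0 : ∀ {r}, 0 < r → 0 < I r := fun hr => h.integral_pow_pos m hr
  have hId : ∀ {r}, 0 < r → HasDerivAt I (ψ r ^ m) r := fun hr => h.hasDerivAt_integral_pow m hr
  have hA : ∀ {r}, 0 < r →
      HasDerivAt (fun r => I r ^ α) (ψ r ^ m * α * I r ^ (α - 1)) r := fun hr =>
    (hId hr).rpow_const (Or.inl (hI0 hr).ne')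
  have hA' : ∀ {r}, 0 < r → HasDerivAt (fun r => ψ r ^ m * α * I r ^ (α - 1))
      ((m * ψ r ^ (m - 1) * deriv ψ r) * α * I r ^ (α - 1) +
        ψ r ^ m * α * (ψ r ^ m * (α - 1) * I r ^ (α - 1 - 1))) r := fun hr =>
    (((h.hasDerivAt hr).fun_pow m).mul_const α).fun_mul
      ((hId hr).rpow_const (Or.inl (hI0 hr).ne'))
  refine convexOn_of_hasDerivWithinAt2_nonneg (convex_Ici R)
    (fun x hx => (hA (hR.trans_le hx)).continuousAt.continuousWithinAt)
    (fun x hx => (hA (hR.trans_le (interior_subset hx))).hasDerivWithinAt)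
    (fun x hx => (hA' (hR.trans_le (interior_subset hx))).hasDerivWithinAt) ?_
  intro x hx
  have hxR : R ≤ x := interior_subset (s := Ici R) hx
  have hx0 := hR.trans_le hxR
  have hψ := h.pos hx0
  have hsplit : I x ^ (α - 1) = I x ^ (α - 1 - 1) * I x := by
    rw [Real.rpow_sub_one (hI0 hx0).ne' (α - 1), div_mul_cancel₀ _ (hI0 hx0).ne']
  have heq : (m * ψ x ^ (m - 1) * deriv ψ x) * α * I x ^ (α - 1) +
        ψ x ^ m * α * (ψ x ^ m * (α - 1) * I x ^ (α - 1 - 1)) =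
      α * ψ x ^ m * I x ^ (α - 1 - 1) *
        (m * (deriv ψ x / ψ x) * I x - (1 - α) * ψ x ^ m) := by
    rw [hsplit]
    obtain ⟨k, rfl⟩ := Nat.exists_eq_succ_of_ne_zero hm.ne'
    simp only [Nat.succ_eq_add_one, Nat.add_sub_cancel, pow_succ (ψ x)]
    field_simp
    ring
  rw [heq]
  have := hI0 hx0
  exact mul_nonneg (by positivity) (sub_nonneg.2 (hle x hxR))

end H1

/-- If ψ'/ψ → l ∈ (0,∞] (with bounded logarithmic derivative of ψ'/ψ when l = ∞),
then A is eventually convex at +∞. -/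
theorem statement11 (n : ℕ) (hn : 3 ≤ n) (p : ℝ) (hp : 1 < p) (ψ : ℝ → ℝ)
    (h1 : H1 ψ) (h2 : H2 ψ)
    (hl : (∃ l : ℝ, 0 < l ∧ Tendsto (fun r => deriv ψ r / ψ r) atTop (nhds l)) ∨
          (Tendsto (fun r => deriv ψ r / ψ r) atTop atTop ∧ LogDerivBounded ψ)) :
    ∃ R : ℝ, 0 < R ∧ ConvexOn ℝ (Ici R) (Afun n p ψ) := by
  have hα0 : 0 < (p - 1) / (2 * (p + 1)) := div_pos (by linarith) (by linarith)
  have hα1 : (p - 1) / (2 * (p + 1)) < 1 := by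
    rw [div_lt_one (by linarith)]
    linarith
  have hm : 0 < n - 1 := by omega
  have key : ∀ᶠ r in atTop, (1 - (p - 1) / (2 * (p + 1))) * ψ r ^ (n - 1) ≤
      ((n - 1 : ℕ) : ℝ) * (deriv ψ r / ψ r) * ∫ s in Ioc (0 : ℝ) r, ψ s ^ (n - 1) := by
    rcases hl with ⟨l, hl0, ht⟩ | ⟨ht, hb⟩
    · exact h1.eventually_mul_pow_le_of_tendsto_nhds h2 hm (by linarith) (by linarith) hl0 ht
    · exact h1.eventually_mul_pow_le_of_tendsto_atTop h2 hm (by linarith) (by linarith) ht hb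
  obtain ⟨R, hR⟩ := eventually_atTop.1 (key.and (eventually_gt_atTop 0))
  exact ⟨R, (hR R le_rfl).2,
    h1.convexOn_integral_pow_rpow hm hα0.le (hR R le_rfl).2 fun r hr => (hR r hr).1⟩
end
end

section
/- Let n ≥ 11 and p ≥ p_c(n). Assume ψ satisfies (H1)–(H3). For α ≥ 0 let u_α denote the unique radial solution with initial value α. Then exactly one of the following alternatives holds: either u_α is stable for every α ≥ 0, or there exists α₀ ∈ (0, ∞) such that u_α is stable for every α ∈ [0, α₀] and unstable for every α > α₀. -/
open Real MeasureTheory Filter Set Asymptotics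

noncomputable section

/-- Linearized stability of a radial solution. -/
def Stable (n : ℕ) (p : ℝ) (ψ u : ℝ → ℝ) : Prop :=
  ∀ χ : ℝ → ℝ, ContDiff ℝ 1 χ → HasCompactSupport χ →
    p * ∫ r in Ioi (0:ℝ), |u r| ^ (p - 1) * (χ r) ^ 2 * ψ r ^ (n - 1) ≤
      ∫ r in Ioi (0:ℝ), (deriv χ r) ^ 2 * ψ r ^ (n - 1)

/-- The Joseph–Lundgren exponent. -/
def pJL (n : ℕ) : ℝ :=
  (((n : ℝ) - 2) ^ 2 - 4 * (n : ℝ) + 8 * Real.sqrt ((n : ℝ) - 1)) /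
    (((n : ℝ) - 2) * ((n : ℝ) - 10))

/-- A nonnegative weight on the half-line, positive and nondecreasing away from the origin. -/
structure IsWeight (W : ℝ → ℝ) : Prop where
  cont : ContinuousOn W (Ici 0)
  zero : W 0 = 0
  pos : ∀ r > (0 : ℝ), 0 < W r
  mono : MonotoneOn W (Ici 0)

/-- The quadratic form `∫ (χ'² - Q χ²) W` is nonnegative on compactly supported C¹ functions. -/
def StablePotential (W Q : ℝ → ℝ) : Prop :=
  ∀ χ : ℝ → ℝ, ContDiff ℝ 1 χ → HasCompactSupport χ →
    ∫ r in Ioi (0:ℝ), Q r * (χ r) ^ 2 * W r ≤ ∫ r in Ioi (0:ℝ), (deriv χ r) ^ 2 * W r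

/-- `w` solves `(W w')' = -W g` on the half-line, with `v` its derivative. -/
structure RadialODE (W w v g : ℝ → ℝ) : Prop where
  cont : ContinuousOn w (Ici 0)
  cont_deriv : ContinuousOn v (Ici 0)
  cont_source : ContinuousOn g (Ici 0)
  hasDeriv : ∀ r > (0 : ℝ), HasDerivAt w (v r) r
  hasDeriv_flux : ∀ r > (0 : ℝ), HasDerivAt (fun s => W s * v s) (-(W r * g r)) r

theorem IsWeight.nonneg {W : ℝ → ℝ} (hW : IsWeight W) {r : ℝ} (hr : 0 ≤ r) : 0 ≤ W r := by
  rw [← hW.zero]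
  exact hW.mono self_mem_Ici hr hr

theorem integrableOn_Ioi_of_eventually_zero {F : ℝ → ℝ} {R : ℝ} (hF : ContinuousOn F (Ici 0))
    (hz : ∀ r, R < r → F r = 0) : IntegrableOn F (Ioi 0) := by
  have h : IntegrableOn F (Icc 0 R) :=
    (hF.mono Icc_subset_Ici_self).integrableOn_compact isCompact_Icc
  refine h.of_forall_sdiff_eq_zero measurableSet_Ioi fun x hx => hz x ?_
  by_contra! hle
  exact hx.2 ⟨(mem_Ioi.1 hx.1).le, hle⟩

theorem setIntegral_Ioi_eq_intervalIntegral {F : ℝ → ℝ} {R : ℝ} (hR : 0 ≤ R)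
    (hz : ∀ r, R < r → F r = 0) : ∫ r in Ioi (0:ℝ), F r = ∫ r in (0:ℝ)..R, F r := by
  rw [intervalIntegral.integral_of_le hR]
  refine setIntegral_eq_of_subset_of_forall_sdiff_eq_zero measurableSet_Ioi Ioc_subset_Ioi_self
    fun x hx => hz x ?_
  by_contra! hle
  exact hx.2 ⟨hx.1, hle⟩

theorem HasCompactSupport.exists_radius {χ : ℝ → ℝ} (h : HasCompactSupport χ) :
    ∃ R > 0, ∀ r, R ≤ r → χ r = 0 := by
  obtain ⟨R, hR⟩ := h.isCompact.isBounded.subset_closedBall 0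
  refine ⟨|R| + 1, by positivity, fun r hr => ?_⟩
  by_contra hne
  have := hR (subset_tsupport χ hne)
  rw [mem_closedBall_zero_iff, Real.norm_eq_abs] at this
  linarith [le_abs_self r, le_abs_self R]

theorem deriv_eq_zero_of_forall_ge {χ : ℝ → ℝ} {R r : ℝ} (h : ∀ s, R ≤ s → χ s = 0) (hr : R < r) :
    deriv χ r = 0 := by
  have : χ =ᶠ[nhds r] fun _ => 0 := by
    filter_upwards [Ioi_mem_nhds hr] with s hs using h s (le_of_lt hs)
  rw [this.deriv_eq, deriv_const]

theorem StablePotential.mono {W Q Q' : ℝ → ℝ} (hW : IsWeight W) (h : StablePotential W Q)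
    (hQ : ContinuousOn Q (Ici 0)) (hQ' : ContinuousOn Q' (Ici 0))
    (hle : ∀ r, 0 < r → Q' r ≤ Q r) : StablePotential W Q' := by
  intro χ hχ hc
  obtain ⟨R, -, hR⟩ := hc.exists_radius
  have hχc : ContinuousOn χ (Ici 0) := hχ.continuous.continuousOn
  refine le_trans (setIntegral_mono_on ?_ ?_ measurableSet_Ioi fun r hr => ?_) (h χ hχ hc)
  · exact integrableOn_Ioi_of_eventually_zero (R := R) ((hQ'.mul (hχc.pow 2)).mul hW.cont)
      fun r hr => by simp [hR r hr.le]
  · exact integrableOn_Ioi_of_eventually_zero (R := R) ((hQ.mul (hχc.pow 2)).mul hW.cont)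
      fun r hr => by simp [hR r hr.le]
  · have := hW.pos r hr
    have := hle r hr
    gcongr

/-- A function vanishing at `R` whose derivative vanishes at `0` and `R` extends to an even
compactly supported C¹ function. -/
theorem exists_contDiff_extension {R : ℝ} (hR : 0 < R) {H k : ℝ → ℝ}
    (hH : ContinuousOn H (Icc 0 R)) (hk : ContinuousOn k (Icc 0 R)) (hk0 : k 0 = 0) (hkR : k R = 0)
    (hHR : H R = 0) (hd : ∀ r ∈ Ioo 0 R, HasDerivAt H (k r) r) :
    ∃ χ : ℝ → ℝ, ContDiff ℝ 1 χ ∧ HasCompactSupport χ ∧ (∀ r ∈ Icc 0 R, χ r = H r) ∧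
      (∀ r ∈ Icc 0 R, deriv χ r = k r) ∧ (∀ r, R ≤ r → χ r = 0) := by
  set K : ℝ → ℝ := fun r => k (projIcc 0 R hR.le r) with hK
  have hKc : Continuous K := by
    have : Continuous ((Icc 0 R).domRestrict k) := hk.domRestrict
    exact this.comp continuous_projIcc
  have hK_left : ∀ r ≤ 0, K r = 0 := fun r hr => by simp [hK, projIcc_of_le_left _ hr, hk0]
  have hK_right : ∀ r, R ≤ r → K r = 0 := fun r hr => by simp [hK, projIcc_of_right_le _ hr, hkR]
  have hK_mid : ∀ r ∈ Icc 0 R, K r = k r := fun r hr => by simp [hK, projIcc_of_mem _ hr]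
  set D : ℝ → ℝ := fun r => K r - K (-r) with hD
  have hDc : Continuous D := hKc.sub (hKc.comp continuous_neg)
  have hD_mid : ∀ r ∈ Icc 0 R, D r = k r := fun r hr => by
    simp [hD, hK_mid r hr, hK_left (-r) (by linarith [hr.1])]
  have hD_right : ∀ r, R ≤ r → D r = 0 := fun r hr => by
    simp [hD, hK_right r hr, hK_left (-r) (by linarith)]
  have hD_left : ∀ r, r ≤ -R → D r = 0 := fun r hr => by
    simp [hD, hK_left r (by linarith), hK_right (-r) (by linarith)]
  have hD_odd : ∫ x in (-R)..R, D x = 0 := by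
    have h := intervalIntegral.integral_comp_neg (a := -R) (b := R) D
    have h2 : (fun x => D (-x)) = fun x => -D x := by ext x; simp [hD]
    rw [h2, intervalIntegral.integral_neg, neg_neg] at h
    linarith
  have hder : ∀ r, HasDerivAt (fun r => ∫ x in R..r, D x) (D r) r := fun r =>
    (hDc.integral_hasStrictDerivAt R r).hasDerivAt
  have hzero : ∀ r, R ≤ r → ∫ x in R..r, D x = 0 := fun r hr => by
    refine intervalIntegral.integral_zero_ae (Eventually.of_forall fun x hx => ?_)
    rw [uIoc_of_le hr] at hx
    exact hD_right x hx.1.le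
  have hzero' : ∀ r, r ≤ -R → ∫ x in R..r, D x = 0 := fun r hr => by
    rw [← intervalIntegral.integral_add_adjacent_intervals (b := -R)
      (hDc.intervalIntegrable _ _) (hDc.intervalIntegrable _ _),
      intervalIntegral.integral_symm, hD_odd, neg_zero, zero_add]
    refine intervalIntegral.integral_zero_ae (Eventually.of_forall fun x hx => ?_)
    rw [uIoc_of_ge hr] at hx
    exact hD_left x hx.2
  refine ⟨fun r => ∫ x in R..r, D x, ?_, ?_, fun r hr => ?_, fun r hr => ?_, hzero⟩
  · rw [contDiff_one_iff_deriv]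
    refine ⟨fun r => (hder r).differentiableAt, ?_⟩
    have : deriv (fun r => ∫ x in R..r, D x) = D := funext fun r => (hder r).deriv
    rwa [this]
  · refine HasCompactSupport.of_support_subset_isCompact (isCompact_Icc (a := -R) (b := R)) ?_
    intro r hr
    by_contra hn
    refine hr ?_
    rcases le_or_gt r (-R) with h | h
    · exact hzero' r h
    · exact hzero r (le_of_not_ge fun h' => hn ⟨h.le, h'⟩)
  · have hsub : Icc r R ⊆ Icc 0 R := Icc_subset_Icc_left hr.1
    have h := intervalIntegral.integral_eq_sub_of_hasDerivAt_of_le hr.2 (hH.mono hsub)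
      (f' := D) (fun x hx => by
        have hx' : x ∈ Ioo 0 R := ⟨hr.1.trans_lt hx.1, hx.2⟩
        rw [hD_mid x (Ioo_subset_Icc_self hx')]
        exact hd x hx') (hDc.intervalIntegrable _ _)
    change ∫ x in R..r, D x = H r
    rw [intervalIntegral.integral_symm, h, hHR]
    ring
  · rw [(hder r).deriv, hD_mid r hr]

theorem StablePotential.integral_le {W Q : ℝ → ℝ} (h : StablePotential W Q)
    {R : ℝ} (hR : 0 < R) {H k : ℝ → ℝ}
    (hH : ContinuousOn H (Icc 0 R)) (hk : ContinuousOn k (Icc 0 R)) (hk0 : k 0 = 0) (hkR : k R = 0)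
    (hHR : H R = 0) (hd : ∀ r ∈ Ioo 0 R, HasDerivAt H (k r) r) :
    ∫ r in (0:ℝ)..R, Q r * H r ^ 2 * W r ≤ ∫ r in (0:ℝ)..R, k r ^ 2 * W r := by
  obtain ⟨χ, hχ, hc, hχH, hχk, hz⟩ := exists_contDiff_extension hR hH hk hk0 hkR hHR hd
  have := h χ hχ hc
  rw [setIntegral_Ioi_eq_intervalIntegral hR.le (fun r hr => by simp [hz r hr.le]),
    setIntegral_Ioi_eq_intervalIntegral hR.le
      (fun r hr => by simp [deriv_eq_zero_of_forall_ge hz hr])] at this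
  convert this using 1
  · refine intervalIntegral.integral_congr fun r hr => ?_
    rw [uIcc_of_le hR.le] at hr
    simp only [hχH r hr]
  · refine intervalIntegral.integral_congr fun r hr => ?_
    rw [uIcc_of_le hR.le] at hr
    simp only [hχk r hr]

theorem RadialODE.abs_deriv_le {W w v g : ℝ → ℝ} (hW : IsWeight W) (h : RadialODE W w v g)
    {r : ℝ} (hr : 0 < r) : |v r| ≤ ∫ s in (0:ℝ)..r, |g s| := by
  have hsub : Icc 0 r ⊆ Ici (0:ℝ) := Icc_subset_Ici_self
  have hWc := hW.cont.mono hsub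
  have hgc := h.cont_source.mono hsub
  have hF := intervalIntegral.integral_eq_sub_of_hasDerivAt_of_le hr.le
    (hWc.mul (h.cont_deriv.mono hsub)) (fun x hx => h.hasDeriv_flux x hx.1)
    ((hWc.mul hgc).neg.intervalIntegrable_of_Icc hr.le)
  have h1 : |W r * v r| ≤ ∫ s in (0:ℝ)..r, W r * |g s| := by
    have h2 : W r * v r = ∫ s in (0:ℝ)..r, -(W s * g s) := by
      simp only [Pi.mul_apply, hW.zero, zero_mul, sub_zero] at hF
      exact hF.symm
    rw [h2]
    refine (intervalIntegral.abs_integral_le_integral_abs hr.le).trans ?_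
    refine intervalIntegral.integral_mono_on hr.le
      ((hWc.mul hgc).neg.abs.intervalIntegrable_of_Icc hr.le)
      ((continuousOn_const.mul hgc.abs).intervalIntegrable_of_Icc hr.le) fun s hs => ?_
    rw [abs_neg, abs_mul, abs_of_nonneg (hW.nonneg hs.1)]
    exact mul_le_mul_of_nonneg_right (hW.mono hs.1 hr.le hs.2) (abs_nonneg _)
  rw [intervalIntegral.integral_const_mul, abs_mul, abs_of_pos (hW.pos r hr)] at h1
  exact le_of_mul_le_mul_left h1 (hW.pos r hr)

theorem continuous_comp_max {F : ℝ → ℝ} (hF : ContinuousOn F (Ici 0)) :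
    Continuous fun r => F (max r 0) :=
  hF.comp_continuous (by fun_prop) fun r => le_max_right r 0

theorem integral_comp_max {F : ℝ → ℝ} {r : ℝ} (hr : 0 ≤ r) :
    ∫ s in (0:ℝ)..r, F (max s 0) = ∫ s in (0:ℝ)..r, F s := by
  refine intervalIntegral.integral_congr fun s hs => ?_
  rw [uIcc_of_le hr] at hs
  simp only [max_eq_left hs.1]

theorem hasDerivAt_integral_comp_max {F : ℝ → ℝ} (hF : ContinuousOn F (Ici 0)) {r : ℝ}
    (hr : 0 ≤ r) : HasDerivAt (fun t => ∫ s in (0:ℝ)..t, F (max s 0)) (F r) r := by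
  have := ((continuous_comp_max hF).integral_hasStrictDerivAt 0 r).hasDerivAt
  rwa [max_eq_left hr] at this

theorem RadialODE.deriv_zero {W w v g : ℝ → ℝ} (hW : IsWeight W) (h : RadialODE W w v g) :
    v 0 = 0 := by
  have hcl : (0:ℝ) ∈ closure (Ioi (0:ℝ)) := by simp
  have hI : Continuous fun t => ∫ s in (0:ℝ)..t, |g (max s 0)| :=
    intervalIntegral.continuous_primitive
      (fun a b => (continuous_comp_max h.cont_source).abs.intervalIntegrable a b) 0
  have := ContinuousWithinAt.closure_le hcl
    (((h.cont_deriv 0 self_mem_Ici).mono Ioi_subset_Ici_self).abs) hI.continuousWithinAt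
    fun r hr => (h.abs_deriv_le hW hr).trans_eq (integral_comp_max (F := fun s => |g s|)
      (le_of_lt hr)).symm
  simpa using this

theorem RadialODE.le_initial {W w v g : ℝ → ℝ} (hW : IsWeight W) (h : RadialODE W w v g)
    {R : ℝ} (hg : ∀ r ∈ Ioo 0 R, 0 ≤ g r) {r : ℝ} (hr : r ∈ Icc 0 R) : w r ≤ w 0 := by
  have hsub : Icc 0 R ⊆ Ici (0:ℝ) := Icc_subset_Ici_self
  have hflux : AntitoneOn (fun s => W s * v s) (Icc 0 R) := by
    refine antitoneOn_of_deriv_nonpos (convex_Icc 0 R)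
      ((hW.cont.mono hsub).mul (h.cont_deriv.mono hsub)) ?_ ?_ <;> rw [interior_Icc]
    · exact fun s hs => (h.hasDeriv_flux s hs.1).differentiableAt.differentiableWithinAt
    · intro s hs
      rw [(h.hasDeriv_flux s hs.1).deriv]
      have := mul_nonneg (hW.pos s hs.1).le (hg s hs)
      linarith
  have h0R : (0:ℝ) ≤ R := hr.1.trans hr.2
  have hv : ∀ s ∈ Ioo 0 R, v s ≤ 0 := fun s hs => by
    have := hflux (left_mem_Icc.2 h0R) (Ioo_subset_Icc_self hs) hs.1.le
    simp only [hW.zero, zero_mul] at this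
    exact nonpos_of_mul_nonpos_right this (hW.pos s hs.1)
  have hanti : AntitoneOn w (Icc 0 R) := by
    refine antitoneOn_of_deriv_nonpos (convex_Icc 0 R) (h.cont.mono hsub) ?_ ?_ <;>
      rw [interior_Icc]
    · exact fun s hs => (h.hasDeriv s hs.1).differentiableAt.differentiableWithinAt
    · intro s hs
      rw [(h.hasDeriv s hs.1).deriv]
      exact hv s hs
  exact hanti (left_mem_Icc.2 h0R) hr hr.1

/-- Continuous dependence on the initial value for sources with linear growth. -/
theorem RadialODE.abs_le_exp {W w v g : ℝ → ℝ} (hW : IsWeight W) (h : RadialODE W w v g)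
    {L R : ℝ} (hL : 0 < L) (hR : 0 < R) (hg : ∀ r ∈ Icc 0 R, |g r| ≤ L * |w r|) :
    |w R| ≤ |w 0| * Real.exp (L * R * R) := by
  set I : ℝ → ℝ := fun t => ∫ s in (0:ℝ)..t, |w (max s 0)| with hI
  have hId : ∀ r, 0 ≤ r → HasDerivAt I |w r| r := fun r hr =>
    hasDerivAt_integral_comp_max h.cont.abs hr
  have hInn : ∀ r, 0 ≤ r → 0 ≤ I r := fun r hr =>
    intervalIntegral.integral_nonneg hr fun _ _ => abs_nonneg _
  have hImono : MonotoneOn I (Ici 0) := by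
    refine monotoneOn_of_deriv_nonneg (convex_Ici 0)
      (fun r hr => (hId r hr).continuousAt.continuousWithinAt) ?_ ?_ <;> rw [interior_Ici]
    · exact fun r hr => (hId r (le_of_lt hr)).differentiableAt.differentiableWithinAt
    · intro r hr
      rw [(hId r (le_of_lt hr)).deriv]
      exact abs_nonneg _
  have hv : ∀ r ∈ Ioc 0 R, |v r| ≤ L * I r := fun r hr => by
    refine (h.abs_deriv_le hW hr.1).trans ?_
    change _ ≤ L * ∫ s in (0:ℝ)..r, |w (max s 0)|
    rw [integral_comp_max (F := fun s => |w s|) hr.1.le, ← intervalIntegral.integral_const_mul]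
    have hsub : Icc 0 r ⊆ Ici (0:ℝ) := Icc_subset_Ici_self
    exact intervalIntegral.integral_mono_on hr.1.le
      ((h.cont_source.mono hsub).abs.intervalIntegrable_of_Icc hr.1.le)
      ((continuousOn_const.mul (h.cont.mono hsub).abs).intervalIntegrable_of_Icc hr.1.le)
      fun s hs => hg s ⟨hs.1, hs.2.trans hr.2⟩
  have hw : ∀ r ∈ Icc 0 R, |w r| ≤ L * R * I r + |w 0| := fun r hr => by
    rcases hr.1.eq_or_lt with rfl | hr0
    · have := mul_nonneg (mul_pos hL hR).le (hInn 0 le_rfl)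
      linarith
    have hb : |w r - w 0| ≤ L * I r * r := by
      have hsub : Icc 0 r ⊆ Ici (0:ℝ) := Icc_subset_Ici_self
      rw [← intervalIntegral.integral_eq_sub_of_hasDerivAt_of_le hr.1 (h.cont.mono hsub)
        (fun x hx => h.hasDeriv x hx.1)
        ((h.cont_deriv.mono hsub).intervalIntegrable_of_Icc hr.1)]
      have := intervalIntegral.norm_integral_le_of_norm_le_const (a := 0) (b := r) (f := v)
        (C := L * I r) fun x hx => by
          rw [uIoc_of_le hr.1] at hx
          refine (hv x ⟨hx.1, hx.2.trans hr.2⟩).trans ?_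
          exact mul_le_mul_of_nonneg_left (hImono hx.1.le hr.1 hx.2) hL.le
      rwa [sub_zero, abs_of_pos hr0, Real.norm_eq_abs] at this
    have hb' : L * I r * r ≤ L * I r * R :=
      mul_le_mul_of_nonneg_left hr.2 (mul_nonneg hL.le (hInn r hr.1))
    have := abs_sub_abs_le_abs_sub (w r) (w 0)
    linarith
  have hK : L * R ≠ 0 := (mul_pos hL hR).ne'
  have hG := norm_le_gronwallBound_of_norm_deriv_right_le (f := I) (f' := fun r => |w r|)
    (δ := 0) (K := L * R) (ε := |w 0|) (a := 0) (b := R)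
    (fun r hr => (hId r hr.1).continuousAt.continuousWithinAt)
    (fun r hr => (hId r hr.1).hasDerivWithinAt) (by simp [hI])
    (fun r hr => by
      rw [Real.norm_eq_abs, abs_abs, Real.norm_eq_abs, abs_of_nonneg (hInn r hr.1)]
      exact hw r ⟨hr.1, hr.2.le⟩) R ⟨hR.le, le_rfl⟩
  rw [gronwallBound_of_K_ne_0 hK, Real.norm_eq_abs, abs_of_nonneg (hInn R hR.le)] at hG
  refine (hw R ⟨hR.le, le_rfl⟩).trans ?_
  refine (add_le_add_left (mul_le_mul_of_nonneg_left hG (mul_pos hL hR).le) _).trans_eq ?_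
  have h1 : L ≠ 0 := hL.ne'
  have h2 : R ≠ 0 := hR.ne'
  simp only [sub_zero]
  field_simp
  ring

/-- The test function `w ^ (1 + δ)` in the quadratic form. -/
theorem StablePotential.integral_rpow_nonpos {W Q w v g : ℝ → ℝ} (hW : IsWeight W)
    (hQ : ContinuousOn Q (Ici 0)) (hS : StablePotential W Q) (h : RadialODE W w v g) {R : ℝ}
    (hR : 0 < R) (hw : ∀ r ∈ Ico 0 R, 0 < w r) (hwR : w R = 0) {δ : ℝ} (hδ : 0 < δ) :
    ∫ r in (0:ℝ)..R, (Q r * w r ^ (2 + 2 * δ)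
      - (1 + δ) ^ 2 / (1 + 2 * δ) * (g r * w r ^ (1 + 2 * δ))) * W r ≤ 0 := by
  have hsub : Icc 0 R ⊆ Ici (0:ℝ) := Icc_subset_Ici_self
  have hWc := hW.cont.mono hsub
  have hwc := h.cont.mono hsub
  have hvc := h.cont_deriv.mono hsub
  have hgc := h.cont_source.mono hsub
  have hQc := hQ.mono hsub
  have hpow : ∀ a : ℝ, 0 ≤ a → ContinuousOn (fun r => w r ^ a) (Icc 0 R) := fun a ha =>
    hwc.rpow_const fun _ _ => Or.inr ha
  have hwnn : ∀ r ∈ Icc 0 R, 0 ≤ w r := fun r hr => by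
    rcases hr.2.eq_or_lt with rfl | hlt
    · exact hwR.ge
    · exact (hw r ⟨hr.1, hlt⟩).le
  have h1 := hS.integral_le hR (H := fun r => w r ^ (1 + δ))
    (k := fun r => v r * (1 + δ) * w r ^ δ) (hpow _ (by linarith))
    ((hvc.mul continuousOn_const).mul (hpow _ hδ.le))
    (by simp [h.deriv_zero hW]) (by simp [hwR, Real.zero_rpow hδ.ne'])
    (by simp [hwR, Real.zero_rpow (by linarith : 1 + δ ≠ 0)])
    (fun r hr => by
      have := (h.hasDeriv r hr.1).rpow_const (p := 1 + δ) (Or.inl (hw r ⟨hr.1.le, hr.2⟩).ne')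
      rwa [add_sub_cancel_left] at this)
  have h2 := intervalIntegral.integral_eq_sub_of_hasDerivAt_of_le hR.le
    (f := fun r => W r * v r * w r ^ (1 + 2 * δ))
    (f' := fun r => -(W r * g r) * w r ^ (1 + 2 * δ)
      + W r * v r * (v r * (1 + 2 * δ) * w r ^ (2 * δ)))
    ((hWc.mul hvc).mul (hpow _ (by linarith)))
    (fun r hr => by
      have := (h.hasDeriv r hr.1).rpow_const (p := 1 + 2 * δ)
        (Or.inl (hw r ⟨hr.1.le, hr.2⟩).ne')
      rw [add_sub_cancel_left] at this
      exact (h.hasDeriv_flux r hr.1).mul this)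
    ((((hWc.mul hgc).neg.mul (hpow _ (by linarith))).add
      ((hWc.mul hvc).mul ((hvc.mul continuousOn_const).mul (hpow _ (by linarith)))
        )).intervalIntegrable_of_Icc hR.le)
  simp only [hW.zero, hwR, Real.zero_rpow (by linarith : 1 + 2 * δ ≠ 0), zero_mul, mul_zero,
    sub_zero] at h2
  set c := (1 + δ) ^ 2 / (1 + 2 * δ) with hc
  have hc' : c * (1 + 2 * δ) = (1 + δ) ^ 2 := by
    rw [hc]
    field_simp
  have h3 : ∫ r in (0:ℝ)..R, (Q r * w r ^ (2 + 2 * δ) - c * (g r * w r ^ (1 + 2 * δ))) * W r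
      = (∫ r in (0:ℝ)..R, Q r * (w r ^ (1 + δ)) ^ 2 * W r)
        - (∫ r in (0:ℝ)..R, (v r * (1 + δ) * w r ^ δ) ^ 2 * W r)
        + c * ∫ r in (0:ℝ)..R, (-(W r * g r) * w r ^ (1 + 2 * δ)
          + W r * v r * (v r * (1 + 2 * δ) * w r ^ (2 * δ))) := by
    rw [← intervalIntegral.integral_const_mul, ← intervalIntegral.integral_sub,
      ← intervalIntegral.integral_add]
    · refine intervalIntegral.integral_congr fun r hr => ?_
      rw [uIcc_of_le hR.le] at hr
      have e1 : (w r ^ (1 + δ)) ^ 2 = w r ^ (2 + 2 * δ) := by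
        rw [← Real.rpow_mul_natCast (hwnn r hr)]
        congr 1
        push_cast
        ring
      have e2 : (w r ^ δ) ^ 2 = w r ^ (2 * δ) := by
        rw [← Real.rpow_mul_natCast (hwnn r hr)]
        congr 1
        push_cast
        ring
      simp only [e1, mul_pow, e2]
      linear_combination (-(v r ^ 2 * w r ^ (2 * δ) * W r)) * hc'
    · exact (((hQc.mul ((hpow _ (by linarith)).pow 2)).mul hWc).sub
        ((((hvc.mul continuousOn_const).mul (hpow _ hδ.le)).pow 2).mul
          hWc)).intervalIntegrable_of_Icc hR.le
    · exact (continuousOn_const.mul (((hWc.mul hgc).neg.mul (hpow _ (by linarith))).add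
        ((hWc.mul hvc).mul ((hvc.mul continuousOn_const).mul
          (hpow _ (by linarith)))))).intervalIntegrable_of_Icc hR.le
    · exact ((hQc.mul ((hpow _ (by linarith)).pow 2)).mul hWc).intervalIntegrable_of_Icc hR.le
    · exact ((((hvc.mul continuousOn_const).mul (hpow _ hδ.le)).pow 2).mul
          hWc).intervalIntegrable_of_Icc hR.le
  rw [h3, h2]
  linarith

/-- A stable potential dominates the potential `g / w` of any positive solution vanishing on the
boundary of a ball. -/
theorem StablePotential.not_forall_lt {W Q w v g : ℝ → ℝ} (hW : IsWeight W)
    (hQ : ContinuousOn Q (Ici 0)) (hS : StablePotential W Q) (h : RadialODE W w v g) {R : ℝ}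
    (hR : 0 < R) (hw : ∀ r ∈ Ico 0 R, 0 < w r) (hwR : w R = 0) :
    ¬ ∀ r ∈ Ioo 0 R, g r < Q r * w r := by
  intro hlt
  have hsub : Icc 0 R ⊆ Ici (0:ℝ) := Icc_subset_Ici_self
  have hWc := hW.cont.mono hsub
  have hwc := h.cont.mono hsub
  have hgc := h.cont_source.mono hsub
  have hQc := hQ.mono hsub
  have hwnn : ∀ r ∈ Icc 0 R, 0 ≤ w r := fun r hr => by
    rcases hr.2.eq_or_lt with rfl | hlt
    · exact hwR.ge
    · exact (hw r ⟨hr.1, hlt⟩).le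
  set Φ : ℝ → ℝ → ℝ := fun δ r => (Q r * w r ^ (2 + 2 * δ)
      - (1 + δ) ^ 2 / (1 + 2 * δ) * (g r * w r ^ (1 + 2 * δ))) * W r with hΦ
  have hΦc : ContinuousOn (fun x : ℝ × ℝ => Φ x.1 x.2) (Icc 0 1 ×ˢ Icc 0 R) := by
    have hfst : ContinuousOn (Prod.fst : ℝ × ℝ → ℝ) (Icc 0 1 ×ˢ Icc 0 R) :=
      continuous_fst.continuousOn
    have hs : ∀ {F : ℝ → ℝ}, ContinuousOn F (Icc 0 R) →
        ContinuousOn (fun x : ℝ × ℝ => F x.2) (Icc 0 1 ×ˢ Icc 0 R) := fun hF =>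
      hF.comp continuous_snd.continuousOn fun x hx => hx.2
    refine (((hs hQc).mul ((hs hwc).rpow (by fun_prop) ?_)).sub
      ((ContinuousOn.div (by fun_prop) (by fun_prop) ?_).mul
        ((hs hgc).mul ((hs hwc).rpow (by fun_prop) ?_)))).mul (hs hWc)
    · exact fun x hx => Or.inr (by linarith [hx.1.1])
    · exact fun x hx => by
        have := hx.1.1
        positivity
    · exact fun x hx => Or.inr (by linarith [hx.1.1])
  obtain ⟨C, hC⟩ := (isCompact_Icc.prod isCompact_Icc).exists_bound_of_continuousOn hΦc
  have hmem : ∀ᶠ δ in nhdsWithin (0:ℝ) (Ioi 0), δ ∈ Ioc (0:ℝ) 1 :=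
    Ioc_mem_nhdsGT one_pos
  have hcr : ∀ δ ∈ Icc (0:ℝ) 1, ContinuousOn (Φ δ) (Icc 0 R) := fun δ hδ =>
    hΦc.comp (f := fun r => (δ, r)) (by fun_prop) fun r hr => ⟨hδ, hr⟩
  have hlim : Tendsto (fun δ => ∫ r in (0:ℝ)..R, Φ δ r) (nhdsWithin 0 (Ioi 0))
      (nhds (∫ r in (0:ℝ)..R, Φ 0 r)) := by
    refine intervalIntegral.tendsto_integral_filter_of_dominated_convergence (fun _ => C)
      ?_ ?_ intervalIntegrable_const ?_
    · filter_upwards [hmem] with δ hδ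
      rw [uIoc_of_le hR.le]
      exact ((hcr δ ⟨hδ.1.le, hδ.2⟩).mono Ioc_subset_Icc_self).aestronglyMeasurable
        measurableSet_Ioc
    · filter_upwards [hmem] with δ hδ
      refine Eventually.of_forall fun r hr => ?_
      rw [uIoc_of_le hR.le] at hr
      exact hC (δ, r) ⟨⟨hδ.1.le, hδ.2⟩, Ioc_subset_Icc_self hr⟩
    · refine Eventually.of_forall fun r hr => ?_
      rw [uIoc_of_le hR.le] at hr
      have hc : ContinuousOn (fun δ => Φ δ r) (Icc 0 1) :=
        hΦc.comp (f := fun δ => (δ, r)) (by fun_prop) fun δ hδ => ⟨hδ, Ioc_subset_Icc_self hr⟩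
      refine (hc 0 ⟨le_rfl, zero_le_one⟩).tendsto.mono_left ?_
      rw [← nhdsWithin_Ioc_eq_nhdsGT (zero_lt_one' ℝ)]
      exact nhdsWithin_mono _ Ioc_subset_Icc_self
  have hle : ∫ r in (0:ℝ)..R, Φ 0 r ≤ 0 := le_of_tendsto hlim <| by
    filter_upwards [self_mem_nhdsWithin] with δ hδ
    exact hS.integral_rpow_nonpos hW hQ h hR hw hwR hδ
  have hΦ0 : ∀ r, Φ 0 r = (Q r * w r - g r) * w r * W r := fun r => by
    simp only [hΦ, mul_zero, add_zero, Real.rpow_two, Real.rpow_one]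
    ring
  have hpos : ∀ r ∈ Ioo 0 R, 0 < Φ 0 r := fun r hr => by
    rw [hΦ0]
    exact mul_pos (mul_pos (sub_pos.2 (hlt r hr)) (hw r ⟨hr.1.le, hr.2⟩)) (hW.pos r hr.1)
  have := intervalIntegral.integral_lt_integral_of_continuousOn_of_le_of_exists_lt hR
    (continuousOn_const (c := (0:ℝ))) (hcr 0 ⟨le_rfl, zero_le_one⟩)
    (fun r hr => by
      rcases hr.2.eq_or_lt with rfl | hrR
      · simp [hΦ0, hwR]
      · exact (hpos r ⟨hr.1, hrR⟩).le)
    ⟨R / 2, ⟨by linarith, by linarith⟩, hpos _ ⟨by linarith, by linarith⟩⟩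
  rw [intervalIntegral.integral_zero] at this
  linarith

/-- A continuous function that is positive at `0` and not positive throughout has a first zero. -/
theorem exists_first_zero {h : ℝ → ℝ} (hc : ContinuousOn h (Ici 0)) (h0 : 0 < h 0) {b : ℝ}
    (hb : 0 ≤ b) (hhb : h b ≤ 0) : ∃ R > 0, h R = 0 ∧ ∀ r ∈ Ico 0 R, 0 < h r := by
  have hcb : ContinuousOn h (Icc 0 b) := hc.mono Icc_subset_Ici_self
  have hK : IsCompact (Icc 0 b ∩ h ⁻¹' Iic 0) :=
    isCompact_Icc.of_isClosed_subset (hcb.preimage_isClosed_of_isClosed isClosed_Icc isClosed_Iic)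
      inter_subset_left
  obtain ⟨R, hR, hmin⟩ := hK.exists_isLeast ⟨b, ⟨hb, le_rfl⟩, hhb⟩
  have hpos : ∀ r ∈ Ico 0 R, 0 < h r := fun r hr => by
    by_contra! hle
    exact absurd (hmin ⟨⟨hr.1, hr.2.le.trans hR.1.2⟩, hle⟩) (not_le.2 hr.2)
  have hR0 : 0 < R := hR.1.1.lt_of_ne (by rintro rfl; exact absurd hR.2 (not_le.2 h0))
  refine ⟨R, hR0, le_antisymm hR.2 ?_, hpos⟩
  have hcl : R ∈ closure (Ico 0 R) := by rw [closure_Ico hR0.ne]; exact ⟨hR0.le, le_rfl⟩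
  exact ContinuousWithinAt.closure_le hcl continuousWithinAt_const
    ((hc R hR0.le).mono Ico_subset_Ici_self) fun r hr => (hpos r hr).le

/-- Hardy-type inequality: a weight dominating its primitive has a spectral gap. -/
theorem stablePotential_const {W : ℝ → ℝ} (hW : IsWeight W) {C : ℝ} (hC : 0 < C)
    (hV : ∀ r, 0 < r → ∫ s in (0:ℝ)..r, W s ≤ C * W r) :
    StablePotential W fun _ => 1 / (4 * C ^ 2) := by
  intro χ hχ hc
  obtain ⟨R, hR, hz⟩ := hc.exists_radius
  rw [setIntegral_Ioi_eq_intervalIntegral hR.le (fun r hr => by simp [hz r hr.le]),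
    setIntegral_Ioi_eq_intervalIntegral hR.le
      (fun r hr => by simp [deriv_eq_zero_of_forall_ge hz hr])]
  set V : ℝ → ℝ := fun r => ∫ s in (0:ℝ)..r, W (max s 0) with hVdef
  have hVd : ∀ r, 0 ≤ r → HasDerivAt V (W r) r := fun r hr =>
    hasDerivAt_integral_comp_max hW.cont hr
  have hVnn : ∀ r, 0 ≤ r → 0 ≤ V r := fun r hr =>
    intervalIntegral.integral_nonneg hr fun s _ => hW.nonneg (le_max_right s 0)
  have hVle : ∀ r, 0 ≤ r → V r ≤ C * W r := fun r hr => by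
    rcases hr.eq_or_lt with rfl | hr0
    · simp [hVdef, hW.zero]
    · exact (integral_comp_max hr).trans_le (hV r hr0)
  have hsub : Icc 0 R ⊆ Ici (0:ℝ) := Icc_subset_Ici_self
  have hWc := hW.cont.mono hsub
  have hVc : ContinuousOn V (Icc 0 R) := fun r hr =>
    (hVd r hr.1).continuousAt.continuousWithinAt
  have hχc : ContinuousOn χ (Icc 0 R) := hχ.continuous.continuousOn
  have hχd : ContinuousOn (deriv χ) (Icc 0 R) := (hχ.continuous_deriv le_rfl).continuousOn
  have hχD : ∀ r, HasDerivAt χ (deriv χ r) r := fun r =>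
    (hχ.differentiable one_ne_zero r).hasDerivAt
  have hint := intervalIntegral.integral_eq_sub_of_hasDerivAt_of_le hR.le
    (f := fun r => χ r ^ 2 * V r) (f' := fun r => 2 * χ r * deriv χ r * V r + χ r ^ 2 * W r)
    ((hχc.pow 2).mul hVc) (fun r hr => by
      have := ((hχD r).pow 2).mul (hVd r hr.1.le)
      exact this.congr_deriv (by simp [mul_assoc]))
    (((((continuousOn_const.mul hχc).mul hχd).mul hVc).add
      ((hχc.pow 2).mul hWc)).intervalIntegrable_of_Icc hR.le)
  have hV0 : V 0 = 0 := by simp [hVdef]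
  simp only [hz R le_rfl, hV0] at hint
  have hmono : ∫ r in (0:ℝ)..R, 1 / (4 * C ^ 2) * χ r ^ 2 * W r ≤
      ∫ r in (0:ℝ)..R, (1 / (2 * C ^ 2) * (2 * χ r * deriv χ r * V r + χ r ^ 2 * W r)
        + deriv χ r ^ 2 * W r) := by
    refine intervalIntegral.integral_mono_on hR.le
      (((continuousOn_const.mul (hχc.pow 2)).mul hWc).intervalIntegrable_of_Icc hR.le)
      (((continuousOn_const.mul ((((continuousOn_const.mul hχc).mul hχd).mul hVc).add
        ((hχc.pow 2).mul hWc))).add ((hχd.pow 2).mul hWc)).intervalIntegrable_of_Icc hR.le)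
      fun r hr => ?_
    have hWr := hW.nonneg hr.1
    have hcross : -(|χ r| * |deriv χ r| * (C * W r)) ≤ χ r * deriv χ r * V r := by
      have h1 : |χ r * deriv χ r * V r| ≤ |χ r| * |deriv χ r| * (C * W r) := by
        rw [abs_mul, abs_mul, abs_of_nonneg (hVnn r hr.1)]
        exact mul_le_mul_of_nonneg_left (hVle r hr.1) (by positivity)
      linarith [neg_abs_le (χ r * deriv χ r * V r)]
    have hsq : 0 ≤ (|χ r| - 2 * C * |deriv χ r|) ^ 2 * W r := mul_nonneg (sq_nonneg _) hWr
    rw [← sq_abs (χ r), ← sq_abs (deriv χ r)]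
    have hid : 1 / (2 * C ^ 2) * (2 * χ r * deriv χ r * V r + |χ r| ^ 2 * W r)
        + |deriv χ r| ^ 2 * W r - 1 / (4 * C ^ 2) * |χ r| ^ 2 * W r
        = 1 / (4 * C ^ 2) * ((|χ r| - 2 * C * |deriv χ r|) ^ 2 * W r
          + 4 * (χ r * deriv χ r * V r + |χ r| * |deriv χ r| * (C * W r))) := by
      field_simp
      ring
    have : 0 ≤ 1 / (4 * C ^ 2) * ((|χ r| - 2 * C * |deriv χ r|) ^ 2 * W r
          + 4 * (χ r * deriv χ r * V r + |χ r| * |deriv χ r| * (C * W r))) :=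
      mul_nonneg (by positivity) (by linarith)
    linarith
  rw [intervalIntegral.integral_add, intervalIntegral.integral_const_mul, hint] at hmono
  · simpa using hmono
  · exact (continuousOn_const.mul ((((continuousOn_const.mul hχc).mul hχd).mul hVc).add
      ((hχc.pow 2).mul hWc))).intervalIntegrable_of_Icc hR.le
  · exact ((hχd.pow 2).mul hWc).intervalIntegrable_of_Icc hR.le

theorem StablePotential.pos {W Q w v g : ℝ → ℝ} (hW : IsWeight W)
    (hQ : ContinuousOn Q (Ici 0)) (hS : StablePotential W Q) (h : RadialODE W w v g)
    (h0 : 0 < w 0)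
    (hlt : ∀ R > 0, (∀ r ∈ Ico 0 R, 0 < w r) → ∀ r ∈ Ioo 0 R, g r < Q r * w r) :
    ∀ r, 0 ≤ r → 0 < w r := by
  intro r hr
  by_contra! hle
  obtain ⟨R, hR, hwR, hpos⟩ := exists_first_zero h.cont h0 hr hle
  exact hS.not_forall_lt hW hQ h hR hpos hwR (hlt R hR hpos)

theorem RadialODE.sub {W w₁ v₁ g₁ w₂ v₂ g₂ : ℝ → ℝ} (h₁ : RadialODE W w₁ v₁ g₁)
    (h₂ : RadialODE W w₂ v₂ g₂) :
    RadialODE W (fun r => w₁ r - w₂ r) (fun r => v₁ r - v₂ r) (fun r => g₁ r - g₂ r) where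
  cont := h₁.cont.sub h₂.cont
  cont_deriv := h₁.cont_deriv.sub h₂.cont_deriv
  cont_source := h₁.cont_source.sub h₂.cont_source
  hasDeriv r hr := (h₁.hasDeriv r hr).sub (h₂.hasDeriv r hr)
  hasDeriv_flux r hr := by
    have h := (h₁.hasDeriv_flux r hr).sub (h₂.hasDeriv_flux r hr)
    refine (h.congr_of_eventuallyEq (Eventually.of_forall fun s => ?_)).congr_deriv (by ring)
    simp only [Pi.sub_apply]
    ring

theorem continuous_abs_rpow {p : ℝ} (hp : 1 < p) : Continuous fun t : ℝ => |t| ^ (p - 1) :=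
  continuous_abs.rpow_const fun _ => Or.inr (by linarith)

theorem hasDerivAt_abs_rpow_mul_self {p : ℝ} (hp : 1 < p) (t : ℝ) :
    HasDerivAt (fun t : ℝ => |t| ^ (p - 1) * t) (p * |t| ^ (p - 1)) t := by
  rcases lt_trichotomy t 0 with ht | rfl | ht
  · have h := ((hasDerivAt_neg t).rpow_const (p := p) (Or.inr hp.le)).neg
    refine (h.congr_of_eventuallyEq ?_).congr_deriv ?_
    · filter_upwards [Iio_mem_nhds ht] with s hs
      have hs' : 0 < -s := neg_pos.2 hs
      rw [abs_of_neg hs]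
      have hs0 : s ≠ 0 := neg_ne_zero.1 hs'.ne'
      simp only [Pi.neg_apply]
      rw [Real.rpow_sub_one hs'.ne']
      field_simp
    · rw [abs_of_neg ht]
      ring
  · rw [hasDerivAt_iff_tendsto_slope]
    have h : Tendsto (fun t : ℝ => |t| ^ (p - 1)) (nhdsWithin 0 {0}ᶜ) (nhds (p * |0| ^ (p - 1))) := by
      have := ((continuous_abs_rpow hp).tendsto 0).mono_left (nhdsWithin_le_nhds (s := {0}ᶜ))
      simpa [Real.zero_rpow (by linarith : p - 1 ≠ 0)] using this
    refine h.congr' ?_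
    filter_upwards [self_mem_nhdsWithin] with s hs
    have hs' : s ≠ 0 := hs
    simp [slope_def_field, hs']
  · have h := (hasDerivAt_id t).rpow_const (p := p) (Or.inr hp.le)
    refine (h.congr_of_eventuallyEq ?_).congr_deriv ?_
    · filter_upwards [Ioi_mem_nhds ht] with s hs
      have hs' : 0 < s := hs
      rw [abs_of_pos hs', Real.rpow_sub_one hs'.ne']
      simp only [id]
      field_simp
    · rw [abs_of_pos ht]
      simp

theorem abs_abs_rpow_mul_self_sub_le {p M a b : ℝ} (hp : 1 < p) (ha : |a| ≤ M) (hb : |b| ≤ M) :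
    |(|a| ^ (p - 1) * a - |b| ^ (p - 1) * b)| ≤ p * M ^ (p - 1) * |a - b| := by
  refine Convex.norm_image_sub_le_of_norm_hasDerivWithin_le (s := Icc (-M) M)
    (f := fun t : ℝ => |t| ^ (p - 1) * t)
    (fun t _ => (hasDerivAt_abs_rpow_mul_self hp t).hasDerivWithinAt) (fun t ht => ?_)
    (convex_Icc _ _) (abs_le.1 hb) (abs_le.1 ha)
  rw [Real.norm_eq_abs, abs_of_nonneg (by positivity)]
  have := abs_le.2 ht
  have := Real.rpow_le_rpow (abs_nonneg t) this (by linarith : 0 ≤ p - 1)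
  gcongr

theorem abs_rpow_mul_self_sub_lt {p a b : ℝ} (hp : 1 < p) (hb : 0 < b) (hab : b < a) :
    |a| ^ (p - 1) * a - |b| ^ (p - 1) * b < p * |a| ^ (p - 1) * (a - b) := by
  have ha : 0 < a := hb.trans hab
  have h := one_add_mul_self_lt_rpow_one_add (s := b / a - 1) (p := p)
    (by have := div_pos hb ha; linarith) (by rw [sub_ne_zero, Ne, div_eq_one_iff_eq ha.ne']
                                             exact hab.ne) hp
  rw [add_sub_cancel, Real.div_rpow hb.le ha.le, lt_div_iff₀ (by positivity)] at h
  rw [abs_of_pos ha, abs_of_pos hb]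
  have e1 : a ^ p = a ^ (p - 1) * a := by rw [← Real.rpow_add_one ha.ne', sub_add_cancel]
  have e2 : b ^ p = b ^ (p - 1) * b := by rw [← Real.rpow_add_one hb.ne', sub_add_cancel]
  rw [← e2]
  have e3 : (1 + p * (b / a - 1)) * a ^ p = a ^ (p - 1) * a + p * a ^ (p - 1) * (b - a) := by
    rw [e1]
    field_simp
  rw [e3] at h
  linarith

theorem isWeight_pow {n : ℕ} (hn : 2 ≤ n) {ψ : ℝ → ℝ} (h1 : H1 ψ) (h2 : H2 ψ) :
    IsWeight fun r => ψ r ^ (n - 1) := by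
  obtain ⟨hc, h0, -, -, hpos⟩ := h1
  have hmono : MonotoneOn ψ (Ici 0) := by
    refine monotoneOn_of_deriv_nonneg (convex_Ici 0) hc.continuousOn ?_ ?_ <;> rw [interior_Ici]
    · exact (hc.differentiableOn two_ne_zero).mono Ioi_subset_Ici_self
    · exact fun r hr => h2 r hr
  have hnn : ∀ r ∈ Ici (0:ℝ), 0 ≤ ψ r := fun r hr => h0 ▸ hmono self_mem_Ici hr hr
  refine ⟨hc.continuousOn.pow _, ?_, fun r hr => pow_pos (hpos r hr) _, fun r hr s hs hrs => ?_⟩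
  · simp only [h0]
    exact zero_pow (by omega)
  · exact pow_le_pow_left₀ (hnn r hr) (hmono hr hs hrs) _

theorem H1.hasDerivAt_pow {n : ℕ} (hn : 2 ≤ n) {ψ : ℝ → ℝ} (h1 : H1 ψ) {r : ℝ} (hr : 0 < r) :
    HasDerivAt (fun r => ψ r ^ (n - 1)) (((n : ℝ) - 1) * (deriv ψ r / ψ r) * ψ r ^ (n - 1)) r := by
  obtain ⟨hc, -, -, -, hpos⟩ := h1
  have hd : HasDerivAt ψ (deriv ψ r) r :=
    ((hc.contDiffAt (Ici_mem_nhds hr)).differentiableAt two_ne_zero).hasDerivAt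
  refine (hd.pow (n - 1)).congr_deriv ?_
  have hne := (hpos r hr).ne'
  obtain ⟨m, rfl⟩ : ∃ m, n = m + 2 := ⟨n - 2, by omega⟩
  have : m + 2 - 1 = m + 1 := by omega
  rw [this]
  simp only [Nat.add_sub_cancel]
  push_cast
  field_simp
  ring

theorem IsRadialSolution.radialODE {n : ℕ} (hn : 2 ≤ n) {p : ℝ} (hp : 1 < p) {ψ u : ℝ → ℝ} {α : ℝ}
    (h1 : H1 ψ) (h : IsRadialSolution n p ψ u α) :
    RadialODE (fun r => ψ r ^ (n - 1)) u (derivWithin u (Ici 0))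
      (fun r => |u r| ^ (p - 1) * u r) := by
  obtain ⟨hc, -, -, heq⟩ := h
  have hv : ∀ r > (0:ℝ), derivWithin u (Ici 0) r = deriv u r := fun r hr =>
    derivWithin_of_mem_nhds (Ici_mem_nhds hr)
  refine ⟨hc.continuousOn, hc.continuousOn_derivWithin (uniqueDiffOn_Ici 0) one_le_two,
    ((continuous_abs_rpow hp).comp_continuousOn hc.continuousOn).mul hc.continuousOn,
    fun r hr => ?_, fun r hr => ?_⟩
  · rw [hv r hr]
    exact ((hc.contDiffAt (Ici_mem_nhds hr)).differentiableAt two_ne_zero).hasDerivAt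
  · have hcr : ContDiffOn ℝ 2 u (Ioi 0) := hc.mono Ioi_subset_Ici_self
    have hd : ContDiffOn ℝ 1 (deriv u) (Ioi 0) :=
      ((contDiffOn_succ_iff_deriv_of_isOpen (n := 1) isOpen_Ioi).1 (by rwa [one_add_one_eq_two])).2.2
    have hd2 : HasDerivAt (deriv u) (deriv (deriv u) r) r :=
      ((hd.contDiffAt (Ioi_mem_nhds hr)).differentiableAt one_ne_zero).hasDerivAt
    have := (h1.hasDerivAt_pow hn hr).mul hd2
    refine (this.congr_of_eventuallyEq ?_).congr_deriv ?_
    · filter_upwards [Ioi_mem_nhds hr] with s hs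
      simp only [Pi.mul_apply, hv s hs]
    · linear_combination (ψ r ^ (n - 1)) * heq r hr

theorem stable_iff_stablePotential {n : ℕ} {p : ℝ} {ψ u : ℝ → ℝ} :
    Stable n p ψ u ↔
      StablePotential (fun r => ψ r ^ (n - 1)) fun r => p * |u r| ^ (p - 1) := by
  unfold Stable StablePotential
  simp only [mul_assoc, MeasureTheory.integral_const_mul]

theorem exists_primitive_le {n : ℕ} (hn : 2 ≤ n) {ψ : ℝ → ℝ} (h1 : H1 ψ) (h2 : H2 ψ) (h3 : H3 ψ) :
    ∃ C > (0:ℝ), ∀ r, 0 < r → ∫ s in (0:ℝ)..r, ψ s ^ (n - 1) ≤ C * ψ r ^ (n - 1) := by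
  have hW := isWeight_pow hn h1 h2
  obtain ⟨c, hc, hev⟩ := h3
  obtain ⟨a, ha⟩ := eventually_atTop.1 hev
  set W : ℝ → ℝ := fun r => ψ r ^ (n - 1) with hWdef
  set r₀ : ℝ := max a 1 with hr₀
  have hr₀1 : 1 ≤ r₀ := le_max_right _ _
  have hr₀pos : 0 < r₀ := by linarith
  have hcpos := inv_pos.2 hc
  have hsmall : ∀ r, 0 < r → r ≤ r₀ → ∫ s in (0:ℝ)..r, W s ≤ (r₀ + c⁻¹) * W r := fun r hr hle => by
    have h : ∫ s in (0:ℝ)..r, W s ≤ ∫ _ in (0:ℝ)..r, W r :=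
      intervalIntegral.integral_mono_on hr.le
        ((hW.cont.mono Icc_subset_Ici_self).intervalIntegrable_of_Icc hr.le)
        intervalIntegrable_const fun s hs => hW.mono hs.1 hr.le hs.2
    rw [intervalIntegral.integral_const, sub_zero, smul_eq_mul] at h
    exact h.trans (mul_le_mul_of_nonneg_right (by linarith) (hW.pos r hr).le)
  refine ⟨r₀ + c⁻¹, by positivity, fun r hr => ?_⟩
  rcases le_total r r₀ with hle | hle
  · exact hsmall r hr hle
  have hd : ∀ s ∈ Ici r₀, HasDerivAt
      (fun s => (r₀ + c⁻¹) * W s - ∫ t in (0:ℝ)..s, W (max t 0))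
      ((r₀ + c⁻¹) * (((n : ℝ) - 1) * (deriv ψ s / ψ s) * W s) - W s) s := fun s hs => by
    have hs0 : 0 < s := hr₀pos.trans_le hs
    exact ((h1.hasDerivAt_pow hn hs0).const_mul _).sub
      (hasDerivAt_integral_comp_max hW.cont hs0.le)
  have hmono : MonotoneOn (fun s => (r₀ + c⁻¹) * W s - ∫ t in (0:ℝ)..s, W (max t 0)) (Ici r₀) := by
    refine monotoneOn_of_deriv_nonneg (convex_Ici r₀)
      (fun s hs => (hd s hs).continuousAt.continuousWithinAt) ?_ ?_ <;> rw [interior_Ici]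
    · exact fun s hs => (hd s (Ioi_subset_Ici_self hs)).differentiableAt.differentiableWithinAt
    · intro s hs
      have hs' := Ioi_subset_Ici_self hs
      rw [(hd s hs').deriv, sub_nonneg]
      have hq : c ≤ deriv ψ s / ψ s := ha s ((le_max_left a 1).trans hs')
      have hn' : (1:ℝ) ≤ (n:ℝ) - 1 := by
        have : (2:ℝ) ≤ n := by exact_mod_cast hn
        linarith
      have hWs := (hW.pos s (hr₀pos.trans_le hs')).le
      have hk : (1:ℝ) ≤ (r₀ + c⁻¹) * (((n:ℝ) - 1) * (deriv ψ s / ψ s)) := by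
        have e1 : c ≤ ((n:ℝ) - 1) * (deriv ψ s / ψ s) := by nlinarith
        calc (1:ℝ) = c⁻¹ * c := (inv_mul_cancel₀ hc.ne').symm
          _ ≤ (r₀ + c⁻¹) * (((n:ℝ) - 1) * (deriv ψ s / ψ s)) := by
            gcongr
            linarith
      nlinarith
  have h := hmono self_mem_Ici hle hle
  simp only [integral_comp_max hr₀pos.le, integral_comp_max hr.le] at h
  linarith [hsmall r₀ hr₀pos le_rfl]

section Comparison

variable {W u v u' v' : ℝ → ℝ} {p : ℝ}

theorem RadialODE.continuousOn_potential (hp : 1 < p)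
    (hu : RadialODE W u v fun r => |u r| ^ (p - 1) * u r) :
    ContinuousOn (fun r => p * |u r| ^ (p - 1)) (Ici 0) :=
  continuousOn_const.mul ((continuous_abs_rpow hp).comp_continuousOn hu.cont)

theorem RadialODE.pos_of_stable (hW : IsWeight W) (hp : 1 < p)
    (hu : RadialODE W u v fun r => |u r| ^ (p - 1) * u r)
    (hS : StablePotential W fun r => p * |u r| ^ (p - 1)) (h0 : 0 < u 0) :
    ∀ r, 0 ≤ r → 0 < u r := by
  refine hS.pos hW (hu.continuousOn_potential hp) hu h0 fun R _ hpos r hr => ?_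
  have hur := hpos r ⟨hr.1.le, hr.2⟩
  have := Real.rpow_pos_of_pos (abs_pos.2 hur.ne') (p - 1)
  gcongr
  nlinarith

theorem RadialODE.lt_of_stable (hW : IsWeight W) (hp : 1 < p)
    (hu : RadialODE W u v fun r => |u r| ^ (p - 1) * u r)
    (hu' : RadialODE W u' v' fun r => |u' r| ^ (p - 1) * u' r)
    (hS : StablePotential W fun r => p * |u r| ^ (p - 1)) (h0 : 0 < u' 0) (hlt : u' 0 < u 0) :
    ∀ r, 0 ≤ r → 0 < u' r ∧ u' r < u r := by
  intro r hr
  by_contra hneg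
  have hQ := hu.continuousOn_potential hp
  obtain ⟨R, hR, hmin, hpos⟩ := exists_first_zero (h := fun r => min (u' r) (u r - u' r))
    (hu'.cont.inf (hu.cont.sub hu'.cont)) (lt_min h0 (sub_pos.2 hlt)) hr (by
      by_contra! h
      rw [lt_min_iff, sub_pos] at h
      exact hneg h)
  have hpos1 : ∀ s ∈ Ico 0 R, 0 < u' s := fun s hs => (lt_min_iff.1 (hpos s hs)).1
  have hpos2 : ∀ s ∈ Ico 0 R, 0 < u s - u' s := fun s hs => (lt_min_iff.1 (hpos s hs)).2
  rcases min_choice (u' R) (u R - u' R) with hc | hc <;> rw [hc] at hmin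
  · refine hS.not_forall_lt hW hQ hu' hR hpos1 hmin fun s hs => ?_
    have h1 := hpos1 s ⟨hs.1.le, hs.2⟩
    have h2 := sub_pos.1 (hpos2 s ⟨hs.1.le, hs.2⟩)
    have h3 := Real.rpow_le_rpow h1.le h2.le (by linarith : 0 ≤ p - 1)
    have h4 := Real.rpow_pos_of_pos h1 (p - 1)
    rw [abs_of_pos h1, abs_of_pos (h1.trans h2)]
    gcongr
    nlinarith
  · refine hS.not_forall_lt hW hQ (hu.sub hu') hR hpos2 hmin fun s hs => ?_
    exact abs_rpow_mul_self_sub_lt hp (hpos1 s ⟨hs.1.le, hs.2⟩)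
      (sub_pos.1 (hpos2 s ⟨hs.1.le, hs.2⟩))

theorem RadialODE.stable_of_lt (hW : IsWeight W) (hp : 1 < p)
    (hu : RadialODE W u v fun r => |u r| ^ (p - 1) * u r)
    (hu' : RadialODE W u' v' fun r => |u' r| ^ (p - 1) * u' r)
    (hS : StablePotential W fun r => p * |u r| ^ (p - 1)) (h0 : 0 < u' 0) (hlt : u' 0 < u 0) :
    StablePotential W fun r => p * |u' r| ^ (p - 1) := by
  refine hS.mono hW (hu.continuousOn_potential hp) (hu'.continuousOn_potential hp) fun r hr => ?_
  obtain ⟨h1, h2⟩ := hu.lt_of_stable hW hp hu' hS h0 hlt r hr.le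
  rw [abs_of_pos h1, abs_of_pos (h1.trans h2)]
  have := Real.rpow_le_rpow h1.le h2.le (by linarith : 0 ≤ p - 1)
  gcongr

theorem RadialODE.exists_bound (hu : RadialODE W u v fun r => |u r| ^ (p - 1) * u r) (R : ℝ) :
    ∃ M > 0, ∀ r ∈ Icc 0 R, |u r| ≤ M := by
  obtain ⟨M, hM⟩ := isCompact_Icc.exists_bound_of_continuousOn
    (hu.cont.mono (Icc_subset_Ici_self : Icc 0 R ⊆ Ici 0))
  exact ⟨max M 1, by positivity, fun r hr => (hM r hr).trans (le_max_left _ _)⟩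

theorem RadialODE.abs_sub_le_exp (hW : IsWeight W) (hp : 1 < p)
    (hu : RadialODE W u v fun r => |u r| ^ (p - 1) * u r)
    (hu' : RadialODE W u' v' fun r => |u' r| ^ (p - 1) * u' r) {M R : ℝ} (hM : 0 < M) (hR : 0 < R)
    (hb : ∀ r ∈ Icc 0 R, |u r| ≤ M) (hb' : ∀ r ∈ Icc 0 R, |u' r| ≤ M) :
    |u R - u' R| ≤ |u 0 - u' 0| * Real.exp (p * M ^ (p - 1) * R * R) :=
  (hu.sub hu').abs_le_exp hW (by positivity) hR fun r hr =>
    abs_abs_rpow_mul_self_sub_le hp (hb r hr) (hb' r hr)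

theorem RadialODE.eq_zero (hW : IsWeight W) (hp : 1 < p)
    (hu : RadialODE W u v fun r => |u r| ^ (p - 1) * u r) (h0 : u 0 = 0) :
    ∀ r, 0 ≤ r → u r = 0 := by
  intro r hr
  rcases hr.eq_or_lt with rfl | hr
  · exact h0
  obtain ⟨M, hM, hb⟩ := hu.exists_bound r
  have h := hu.abs_le_exp hW (L := M ^ (p - 1)) (by positivity) hr fun s hs => by
    rw [abs_mul, abs_of_nonneg (by positivity : 0 ≤ |u s| ^ (p - 1))]
    have := Real.rpow_le_rpow (abs_nonneg _) (hb s hs) (by linarith : 0 ≤ p - 1)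
    gcongr
  rw [h0, abs_zero, zero_mul] at h
  exact abs_nonpos_iff.1 h

theorem RadialODE.le_initial_of_pos (hW : IsWeight W)
    (hu : RadialODE W u v fun r => |u r| ^ (p - 1) * u r) {R : ℝ}
    (hpos : ∀ r ∈ Ioo 0 R, 0 < u r) {r : ℝ} (hr : r ∈ Icc 0 R) : u r ≤ u 0 :=
  hu.le_initial hW (fun s hs => mul_nonneg (by positivity) (hpos s hs).le) hr

/-- Solutions with small initial value are stable when the weight has a spectral gap. -/
theorem RadialODE.stable_of_small (hW : IsWeight W) (hp : 1 < p)
    (hu : RadialODE W u v fun r => |u r| ^ (p - 1) * u r) {l : ℝ}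
    (hl : StablePotential W fun _ => l) (h0 : 0 ≤ u 0)
    (hle : p * u 0 ^ (p - 1) ≤ l) :
    StablePotential W fun r => p * |u r| ^ (p - 1) := by
  have hb : ∀ r, 0 ≤ r → |u r| ≤ u 0 := by
    rcases h0.eq_or_lt with h0 | h0
    · intro r hr
      rw [hu.eq_zero hW hp h0.symm r hr, ← h0, abs_zero]
    have hpos : ∀ r, 0 ≤ r → 0 < u r := by
      refine hl.pos hW continuousOn_const hu h0 fun R _ hpos r hr => ?_
      have hur := hpos r ⟨hr.1.le, hr.2⟩
      have hle' := hu.le_initial_of_pos hW (fun s hs => hpos s ⟨hs.1.le, hs.2⟩)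
        (Ioo_subset_Icc_self hr)
      have h1 := Real.rpow_le_rpow hur.le hle' (by linarith : 0 ≤ p - 1)
      have h2 := Real.rpow_pos_of_pos h0 (p - 1)
      rw [abs_of_pos hur]
      gcongr
      nlinarith
    intro r hr
    rw [abs_of_pos (hpos r hr)]
    exact hu.le_initial_of_pos hW (fun s hs => hpos s hs.1.le) ⟨hr, le_rfl⟩
  refine hl.mono hW continuousOn_const (hu.continuousOn_potential hp) fun r hr => ?_
  refine le_trans ?_ hle
  have := Real.rpow_le_rpow (abs_nonneg _) (hb r hr.le) (by linarith : 0 ≤ p - 1)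
  gcongr

theorem StablePotential.of_tendsto (hW : IsWeight W) (hp : 1 < p) {U : ℕ → ℝ → ℝ} {M : ℝ}
    (hU : ∀ k, ContinuousOn (U k) (Ici 0)) (hb : ∀ k, ∀ r, 0 ≤ r → |U k r| ≤ M)
    (hlim : ∀ r, 0 < r → Tendsto (fun k => U k r) atTop (nhds (u r)))
    (hS : ∀ k, StablePotential W fun r => p * |U k r| ^ (p - 1)) :
    StablePotential W fun r => p * |u r| ^ (p - 1) := by
  intro χ hχ hc
  obtain ⟨R, -, hz⟩ := hc.exists_radius
  have hχc : ContinuousOn χ (Ici 0) := hχ.continuous.continuousOn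
  refine le_of_tendsto' (tendsto_integral_of_dominated_convergence
    (F := fun k r => p * |U k r| ^ (p - 1) * χ r ^ 2 * W r)
    (fun r => p * M ^ (p - 1) * χ r ^ 2 * W r) (fun k => ?_) ?_ (fun k => ?_) ?_)
    fun k => hS k χ hχ hc
  · exact ((((continuousOn_const.mul ((continuous_abs_rpow hp).comp_continuousOn (hU k))).mul
      (hχc.pow 2)).mul hW.cont).mono Ioi_subset_Ici_self).aestronglyMeasurable measurableSet_Ioi
  · exact integrableOn_Ioi_of_eventually_zero (R := R)
      ((continuousOn_const.mul (hχc.pow 2)).mul hW.cont) fun r hr => by simp [hz r hr.le]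
  · filter_upwards [ae_restrict_mem measurableSet_Ioi] with r hr
    have hWr := (hW.pos r hr).le
    rw [Real.norm_eq_abs, abs_of_nonneg (by positivity)]
    have := Real.rpow_le_rpow (abs_nonneg _) (hb k r (le_of_lt hr)) (by linarith : 0 ≤ p - 1)
    gcongr
  · filter_upwards [ae_restrict_mem measurableSet_Ioi] with r hr
    have := ((continuous_abs_rpow hp).tendsto (u r)).comp (hlim r hr)
    exact ((this.const_mul p).mul_const _).mul_const _

/-- Instability persists for slightly smaller initial values. -/
theorem RadialODE.exists_not_stable (hW : IsWeight W) (hp : 1 < p)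
    (hu : RadialODE W u v fun r => |u r| ^ (p - 1) * u r)
    (hS : ¬ StablePotential W fun r => p * |u r| ^ (p - 1)) :
    ∃ ε > 0, ∀ u' v' : ℝ → ℝ, RadialODE W u' v' (fun r => |u' r| ^ (p - 1) * u' r) →
      0 < u' 0 → u 0 - ε < u' 0 → u' 0 ≤ u 0 →
        ¬ StablePotential W fun r => p * |u' r| ^ (p - 1) := by
  by_contra! hcon
  choose U V hUV hU0 hlow hup hUS using
    fun k : ℕ => hcon (1 / ((k : ℝ) + 1)) Nat.one_div_pos_of_nat
  have hbound : ∀ k, ∀ r, 0 ≤ r → |U k r| ≤ u 0 := fun k r hr => by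
    have hpos := (hUV k).pos_of_stable hW hp (hUS k) (hU0 k)
    rw [abs_of_pos (hpos r hr)]
    exact ((hUV k).le_initial_of_pos hW (fun s hs => hpos s hs.1.le) ⟨hr, le_rfl⟩).trans (hup k)
  refine hS (StablePotential.of_tendsto hW hp (fun k => (hUV k).cont) hbound (fun r hr => ?_) hUS)
  obtain ⟨M, hM, hb⟩ := hu.exists_bound r
  have hM0 : u 0 ≤ M := (le_abs_self _).trans (hb 0 ⟨le_rfl, hr.le⟩)
  rw [tendsto_iff_dist_tendsto_zero]
  refine squeeze_zero (fun _ => dist_nonneg)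
    (g := fun k : ℕ => 1 / ((k : ℝ) + 1) * Real.exp (p * M ^ (p - 1) * r * r)) (fun k => ?_) ?_
  · refine ((hUV k).abs_sub_le_exp hW hp hu hM hr
      (fun s hs => (hbound k s hs.1).trans hM0) hb).trans ?_
    gcongr
    rw [abs_le]
    constructor <;> linarith [hlow k, hup k, Nat.one_div_pos_of_nat (α := ℝ) (n := k)]
  · simpa using tendsto_one_div_add_atTop_nhds_zero_nat.mul_const
      (Real.exp (p * M ^ (p - 1) * r * r))

end Comparison

/-- For n ≥ 11 and p ≥ p_c(n): either all radial solutions with nonnegative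
initial value are stable, or there is a finite threshold α₀ ∈ (0,∞) below which
they are stable and above which they are unstable. -/
theorem statement14 (n : ℕ) (hn : 11 ≤ n) (p : ℝ) (hp : 1 < p)
    (hpc : pJL n ≤ p) (ψ : ℝ → ℝ)
    (h1 : H1 ψ) (h2 : H2 ψ) (h3 : H3 ψ) :
    (∀ α : ℝ, 0 ≤ α → ∀ u : ℝ → ℝ, IsRadialSolution n p ψ u α → Stable n p ψ u) ∨
    (∃ α₀ : ℝ, 0 < α₀ ∧
      ∀ α : ℝ, 0 ≤ α → ∀ u : ℝ → ℝ, IsRadialSolution n p ψ u α →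
        ((α ≤ α₀ → Stable n p ψ u) ∧ (α₀ < α → ¬ Stable n p ψ u))) := by
  have hn2 : 2 ≤ n := by omega
  have hW := isWeight_pow hn2 h1 h2
  have hsol : ∀ {α : ℝ} {u : ℝ → ℝ}, IsRadialSolution n p ψ u α → RadialODE
      (fun r => ψ r ^ (n - 1)) u (derivWithin u (Ici 0)) fun r => |u r| ^ (p - 1) * u r :=
    fun hu => hu.radialODE hn2 hp h1
  obtain ⟨C, hC, hV⟩ := exists_primitive_le hn2 h1 h2 h3
  have hl := stablePotential_const hW hC hV
  set l : ℝ := 1 / (4 * C ^ 2)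
  have hlpos : 0 < l := by positivity
  obtain ⟨a, ha, hsmall⟩ : ∃ a > 0, ∀ α, 0 ≤ α → α ≤ a →
      ∀ u, IsRadialSolution n p ψ u α → Stable n p ψ u := by
    refine ⟨(l / p) ^ (1 / (p - 1)), by positivity, fun α hα hle u hu => ?_⟩
    rw [stable_iff_stablePotential]
    refine (hsol hu).stable_of_small hW hp hl (hu.2.1.symm ▸ hα) ?_
    rw [hu.2.1]
    have h := Real.rpow_le_rpow hα hle (by linarith : 0 ≤ p - 1)
    rw [← Real.rpow_mul (by positivity), one_div_mul_cancel (by linarith), Real.rpow_one,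
      le_div_iff₀ (by linarith)] at h
    linarith
  set S : Set ℝ := {α | 0 ≤ α ∧ ∃ u, IsRadialSolution n p ψ u α ∧ ¬ Stable n p ψ u}
  rcases S.eq_empty_or_nonempty with hS | hS
  · refine Or.inl fun α hα u hu => ?_
    by_contra hns
    exact (hS ▸ (⟨hα, u, hu, hns⟩ : α ∈ S) : α ∈ (∅ : Set ℝ))
  right
  have hSa : ∀ α ∈ S, a ≤ α := fun α ⟨hα, u, hu, hns⟩ => by
    by_contra! hlt
    exact hns (hsmall α hα hlt.le u hu)
  have hbdd : BddBelow S := ⟨a, hSa⟩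
  have hma : a ≤ sInf S := le_csInf hS hSa
  set m := sInf S
  have hbelow : ∀ α, 0 ≤ α → α < m → ∀ u, IsRadialSolution n p ψ u α → Stable n p ψ u :=
    fun α hα hlt u hu => by
      by_contra hns
      exact (csInf_le hbdd ⟨hα, u, hu, hns⟩).not_gt hlt
  have habove : ∀ α, m < α → ∀ u, IsRadialSolution n p ψ u α → ¬ Stable n p ψ u :=
    fun α hlt u hu hst => by
      obtain ⟨β, ⟨hβS, hβ⟩⟩ := exists_lt_of_csInf_lt hS hlt
      have hβa := hSa β hβS
      obtain ⟨-, w, hw, hns⟩ := hβS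
      rw [stable_iff_stablePotential] at hst hns
      exact hns ((hsol hu).stable_of_lt hW hp (hsol hw) hst (by rw [hw.2.1]; linarith)
        (by rw [hw.2.1, hu.2.1]; exact hβ))
  by_cases hm : m ∈ S
  · obtain ⟨-, w, hw, hns⟩ := hm
    rw [stable_iff_stablePotential] at hns
    obtain ⟨ε, hε, hun⟩ := (hsol hw).exists_not_stable hW hp hns
    rw [hw.2.1] at hun
    have hmin : 0 < min ε m := lt_min hε (by linarith)
    have hminε := min_le_left ε m
    have hminm := min_le_right ε m
    refine ⟨m - min ε m / 2, by linarith, fun α hα u hu =>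
      ⟨fun hle => hbelow α hα (by linarith) u hu, fun hlt => ?_⟩⟩
    rcases lt_or_ge m α with h | h
    · exact habove α h u hu
    · rw [stable_iff_stablePotential]
      exact hun u _ (hsol hu) (by rw [hu.2.1]; linarith) (by rw [hu.2.1]; linarith)
        (by rwa [hu.2.1])
  · refine ⟨m, by linarith, fun α hα u hu => ⟨fun hle => ?_, fun hlt => habove α hlt u hu⟩⟩
    rcases hle.eq_or_lt with rfl | hlt
    · by_contra hns
      exact hm ⟨hα, u, hu, hns⟩
    · exact hbelow α hα hlt u hu
end
end

section
/- Let n ≥ 3 and p > 1, and assume ψ satisfies (H1)–(H3). Let u be a stable radial solution. If ∫₀^∞ u(r)² ψ(r)^{n−1} dr < ∞, then u is identically zero. -/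
open Real MeasureTheory Filter Set Asymptotics

noncomputable section

/-- A `C¹` function on the half-line `[0, ∞)` extends to a `C¹` function on `ℝ`. -/
theorem exists_contDiff_one_eqOn_Ici {f : ℝ → ℝ} (hf : ContDiffOn ℝ 1 f (Ici 0)) :
    ∃ F : ℝ → ℝ, ContDiff ℝ 1 F ∧ EqOn F f (Ici 0) := by
  have hcont : Continuous fun r => derivWithin f (Ici 0) (max r 0) :=
    (hf.continuousOn_derivWithin (uniqueDiffOn_Ici 0) le_rfl).comp_continuous
      (by fun_prop) fun r => le_max_right r 0
  have hderiv (r : ℝ) : HasDerivAt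
      (fun s => f 0 + ∫ t in (0 : ℝ)..s, derivWithin f (Ici 0) (max t 0))
      (derivWithin f (Ici 0) (max r 0)) r :=
    (hcont.integral_hasStrictDerivAt 0 r).hasDerivAt.const_add _
  refine ⟨fun s => f 0 + ∫ t in (0 : ℝ)..s, derivWithin f (Ici 0) (max t 0), ?_, ?_⟩
  · rw [contDiff_one_iff_deriv]
    exact ⟨fun r => (hderiv r).differentiableAt, by rwa [funext fun r => (hderiv r).deriv]⟩
  · intro r hr
    have hr0 : (0 : ℝ) ≤ r := hr
    have h := intervalIntegral.integral_eq_sub_of_hasDerivAt_of_le hr0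
      (hf.continuousOn.mono Icc_subset_Ici_self)
      (fun t ht => ?_) (hcont.intervalIntegrable 0 r)
    · simp only [h]; ring
    · have hmax : max t 0 = t := max_eq_left ht.1.le
      rw [hmax]
      exact ((hf.differentiableOn one_ne_zero t ht.1.le).hasDerivWithinAt).hasDerivAt
        (Ici_mem_nhds ht.1)

/-- A family of `C¹` cutoffs at scale `R`, with gradient of size `O(1 / R)`. -/
theorem exists_cutoff_family : ∃ C : ℝ, ∀ R > (0 : ℝ), ∃ η : ℝ → ℝ, ContDiff ℝ 1 η ∧
    (∀ r, 2 * R ≤ |r| → η r = 0) ∧ (∀ r, |r| ≤ R → η r = 1) ∧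
    ∀ r, (deriv η r) ^ 2 ≤ C / R ^ 2 := by
  let φ : ContDiffBump (0 : ℝ) := ⟨1, 2, one_pos, one_lt_two⟩
  have hφ : ContDiff ℝ 1 φ := φ.contDiff
  obtain ⟨C, hC⟩ := (hφ.continuous_deriv le_rfl).bounded_above_of_compact_support
    φ.hasCompactSupport.deriv
  refine ⟨C ^ 2, fun R hR => ⟨fun r => φ (r / R), by fun_prop, ?_, ?_, ?_⟩⟩
  · intro r hr
    apply φ.zero_of_le_dist
    rw [Real.dist_eq, sub_zero, abs_div, abs_of_pos hR]
    exact (le_div_iff₀ hR).2 hr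
  · intro r hr
    apply φ.one_of_mem_closedBall
    rw [Metric.mem_closedBall, Real.dist_eq, sub_zero, abs_div, abs_of_pos hR]
    exact (div_le_one hR).2 hr
  · intro r
    have h : HasDerivAt (fun r => φ (r / R)) (deriv φ (r / R) * (1 / R)) r :=
      HasDerivAt.comp (h₂ := φ) (h := fun r => r / R) r
        (hφ.differentiable one_ne_zero (r / R)).hasDerivAt ((hasDerivAt_id r).div_const R)
    rw [h.deriv, mul_pow, div_pow, one_pow, ← div_eq_mul_one_div]
    refine div_le_div_of_nonneg_right ?_ (sq_nonneg R)
    rw [← sq_abs]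
    exact pow_le_pow_left₀ (abs_nonneg _) (hC _) 2

/-- An integral over `(0, ∞)` of a function vanishing beyond `b` is an integral over `[0, b]`. -/
theorem setIntegral_Ioi_eq_intervalIntegral_s15 {f g : ℝ → ℝ} {b : ℝ} (hb : 0 ≤ b)
    (hfg : ∀ r > 0, f r = g r) (hg : ∀ r > b, g r = 0) :
    ∫ r in Ioi (0 : ℝ), f r = ∫ r in (0 : ℝ)..b, g r := by
  rw [setIntegral_congr_fun measurableSet_Ioi (fun r hr => hfg r hr),
    intervalIntegral.integral_of_le hb]
  refine setIntegral_eq_of_subset_of_forall_sdiff_eq_zero measurableSet_Ioi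
    (fun r hr => hr.1) fun r hr => hg r ?_
  by_contra! h
  exact hr.2 ⟨hr.1, h⟩

/-- Energy identity: testing the equation for `deriv U * w`, in divergence form, against `η² U`. -/
theorem integral_deriv_mul_sq_eq {U V w η : ℝ → ℝ} {b : ℝ} (hb : 0 ≤ b)
    (hU : ContDiff ℝ 1 U) (hη : ContDiff ℝ 1 η) (hV : Continuous V) (hw : Continuous w)
    (hw0 : w 0 = 0) (hηb : η b = 0)
    (heq : ∀ r > 0, HasDerivAt (fun s => deriv U s * w s) (-(V r * U r * w r)) r) :
    ∫ r in (0 : ℝ)..b, (deriv (fun s => η s * U s) r) ^ 2 * w r =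
      (∫ r in (0 : ℝ)..b, V r * (η r * U r) ^ 2 * w r) +
        ∫ r in (0 : ℝ)..b, (deriv η r) ^ 2 * (U r ^ 2 * w r) := by
  have cU := hU.continuous
  have cη := hη.continuous
  have cU' := hU.continuous_deriv le_rfl
  have cη' := hη.continuous_deriv le_rfl
  have dU (r : ℝ) : HasDerivAt U (deriv U r) r := (hU.differentiable one_ne_zero r).hasDerivAt
  have dη (r : ℝ) : HasDerivAt η (deriv η r) r := (hη.differentiable one_ne_zero r).hasDerivAt
  have hprod (r : ℝ) : deriv (fun s => η s * U s) r = deriv η r * U r + η r * deriv U r :=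
    ((dη r).mul (dU r)).deriv
  have hFTC := intervalIntegral.integral_eq_sub_of_hasDerivAt_of_le
    (f := fun r => η r ^ 2 * U r * (deriv U r * w r))
    (f' := fun r => (deriv η r * U r + η r * deriv U r) ^ 2 * w r
      - V r * (η r * U r) ^ 2 * w r - (deriv η r) ^ 2 * (U r ^ 2 * w r)) hb
    (by fun_prop) (fun r hr => ?_) (Continuous.intervalIntegrable (by fun_prop) _ _)
  · rw [intervalIntegral.integral_sub (Continuous.intervalIntegrable (by fun_prop) _ _)
      (Continuous.intervalIntegrable (by fun_prop) _ _),
      intervalIntegral.integral_sub (Continuous.intervalIntegrable (by fun_prop) _ _)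
      (Continuous.intervalIntegrable (by fun_prop) _ _), hηb, hw0] at hFTC
    simp only [hprod]
    linarith
  · refine ((((dη r).fun_pow 2).mul (dU r)).mul (heq r hr.1)).congr_deriv ?_
    simp only [Pi.mul_apply]
    ring

/-- Away from the origin, the radial equation is in divergence form. -/
theorem IsRadialSolution.hasDerivAt_deriv_mul {n : ℕ} {p α : ℝ} {ψ u : ℝ → ℝ} (hn : 2 ≤ n)
    (h1 : H1 ψ) (hu : IsRadialSolution n p ψ u α) {r : ℝ} (hr : 0 < r) :
    HasDerivAt (fun s => deriv u s * ψ s ^ (n - 1))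
      (-(|u r| ^ (p - 1) * u r * ψ r ^ (n - 1))) r := by
  have hψr := h1.2.2.2.2 r hr
  have dψ : HasDerivAt ψ (deriv ψ r) r :=
    ((h1.1.contDiffAt (Ici_mem_nhds hr)).differentiableAt two_ne_zero).hasDerivAt
  have du : HasDerivAt (deriv u) (deriv (deriv u) r) r := by
    have h : ContDiffOn ℝ 1 (deriv u) (Ioi 0) :=
      (hu.1.mono Ioi_subset_Ici_self).deriv_of_isOpen isOpen_Ioi (by norm_num)
    exact ((h.contDiffAt (Ioi_mem_nhds hr)).differentiableAt one_ne_zero).hasDerivAt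
  refine (du.mul (dψ.fun_pow (n - 1))).congr_deriv ?_
  obtain ⟨m, rfl⟩ := Nat.exists_eq_add_of_le' hn
  have hode := hu.2.2.2 r hr
  have hdd : deriv (deriv u) r = -(((m + 2 : ℕ) : ℝ) - 1) * (deriv ψ r / ψ r) * deriv u r
      - |u r| ^ (p - 1) * u r := by linarith
  rw [hdd]
  simp only [show m + 2 - 1 = m + 1 by omega, Nat.add_sub_cancel]
  push_cast
  field_simp
  ring

/-- Caccioppoli-type estimate for stable radial solutions. -/
theorem Stable.integral_le {n : ℕ} {p α : ℝ} {ψ u : ℝ → ℝ} (hn : 2 ≤ n) (hp : 1 < p)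
    (h1 : H1 ψ) (hu : IsRadialSolution n p ψ u α) (hstable : Stable n p ψ u)
    {η : ℝ → ℝ} {b : ℝ} (hb : 0 ≤ b) (hη : ContDiff ℝ 1 η) (hηb : ∀ r, b ≤ |r| → η r = 0) :
    (p - 1) * ∫ r in (0 : ℝ)..b, |u r| ^ (p - 1) * (η r * u r) ^ 2 * ψ r ^ (n - 1) ≤
      ∫ r in (0 : ℝ)..b, (deriv η r) ^ 2 * (u r ^ 2 * ψ r ^ (n - 1)) := by
  obtain ⟨U, hU, hUu⟩ := exists_contDiff_one_eqOn_Ici (hu.1.of_le one_le_two)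
  have hUu' {r : ℝ} (hr : 0 < r) : deriv U r = deriv u r :=
    (hUu.eventuallyEq_of_mem (Ici_mem_nhds hr)).deriv_eq
  set w : ℝ → ℝ := fun r => ψ (max r 0) ^ (n - 1) with hwdef
  have hw : Continuous w := (h1.1.continuousOn.comp_continuous (by fun_prop)
    fun r => le_max_right r 0).pow _
  have hwψ {r : ℝ} (hr : 0 ≤ r) : w r = ψ r ^ (n - 1) := by simp [hwdef, hr]
  have hw0 : w 0 = 0 := by
    simp [hwdef, h1.2.1, show n - 1 ≠ 0 by omega]
  have hV : Continuous fun r => |U r| ^ (p - 1) :=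
    hU.continuous.abs.rpow_const fun r => Or.inr (by linarith)
  have heq (r : ℝ) (hr : r > 0) :
      HasDerivAt (fun s => deriv U s * w s) (-(|U r| ^ (p - 1) * U r * w r)) r := by
    rw [hUu hr.le, hwψ hr.le]
    refine (hu.hasDerivAt_deriv_mul hn h1 hr).congr_of_eventuallyEq ?_
    filter_upwards [Ioi_mem_nhds hr] with s hs
    rw [hUu' hs, hwψ (le_of_lt hs)]
  have hχ : ContDiff ℝ 1 fun s => η s * U s := hη.mul hU
  have hsupp : ∀ r, r ∉ Icc (-b) b → η r * U r = 0 := fun r hr => by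
    rw [hηb r, zero_mul]
    by_contra! h
    exact hr (abs_le.1 h.le)
  have hderiv0 : ∀ r > b, deriv (fun s => η s * U s) r = 0 := fun r hr => by
    have : (fun s => η s * U s) =ᶠ[nhds r] fun _ => 0 := by
      filter_upwards [Ioi_mem_nhds hr] with s hs
      exact hsupp s fun h => not_le_of_gt hs h.2
    rw [this.deriv_eq, deriv_const]
  have hst := hstable _ hχ (HasCompactSupport.intro isCompact_Icc hsupp)
  rw [setIntegral_Ioi_eq_intervalIntegral_s15 hb
      (g := fun r => |U r| ^ (p - 1) * (η r * U r) ^ 2 * w r)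
      (fun r hr => by rw [hUu hr.le, hwψ hr.le])
      (fun r hr => by rw [hsupp r fun h => not_le_of_gt hr h.2]; ring),
    setIntegral_Ioi_eq_intervalIntegral_s15 hb
      (g := fun r => (deriv (fun s => η s * U s) r) ^ 2 * w r)
      (fun r hr => by rw [hwψ hr.le])
      (fun r hr => by rw [hderiv0 r hr]; ring),
    integral_deriv_mul_sq_eq hb hU hη hV hw hw0 (hηb b (le_abs_self b)) heq] at hst
  have hnn {r : ℝ} (hr : r ∈ uIcc 0 b) : 0 ≤ r := by
    rw [uIcc_of_le hb] at hr
    exact hr.1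
  rw [intervalIntegral.integral_congr
      (g := fun r => |U r| ^ (p - 1) * (η r * U r) ^ 2 * w r)
      (fun r hr => by simp only [hUu (hnn hr), hwψ (hnn hr)]),
    intervalIntegral.integral_congr
      (f := fun r => (deriv η r) ^ 2 * (u r ^ 2 * ψ r ^ (n - 1)))
      (g := fun r => (deriv η r) ^ 2 * (U r ^ 2 * w r))
      (fun r hr => by simp only [hUu (hnn hr), hwψ (hnn hr)])]
  linarith

/-- Liouville-type result: a stable radial solution lying in L² must vanish
identically. -/
theorem statement15 (n : ℕ) (hn : 3 ≤ n) (p : ℝ) (hp : 1 < p) (ψ : ℝ → ℝ)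
    (h1 : H1 ψ) (h2 : H2 ψ) (h3 : H3 ψ)
    (u : ℝ → ℝ) (α : ℝ) (hu : IsRadialSolution n p ψ u α)
    (hstable : Stable n p ψ u)
    (hL2 : IntegrableOn (fun r => (u r) ^ 2 * ψ r ^ (n - 1)) (Ioi 0)) :
    ∀ r ≥ (0:ℝ), u r = 0 := by
  have hψ := h1.2.2.2.2
  have hn2 : 2 ≤ n := by omega
  set Q : ℝ → ℝ := fun r => |u r| ^ (p - 1) * u r ^ 2 * ψ r ^ (n - 1) with hQ
  have hcQ : ContinuousOn Q (Ici 0) :=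
    ((hu.1.continuousOn.abs.rpow_const fun r _ => Or.inr (by linarith)).mul
      (hu.1.continuousOn.pow 2)).mul (h1.1.continuousOn.pow _)
  have hψ0 : ∀ r ≥ (0 : ℝ), 0 ≤ ψ r ^ (n - 1) := fun r hr => by
    rcases hr.eq_or_lt with rfl | hr
    · rw [h1.2.1]; positivity
    · exact pow_nonneg (hψ r hr).le _
  have hQ0 : ∀ r ≥ (0 : ℝ), 0 ≤ Q r := fun r hr => mul_nonneg (by positivity) (hψ0 r hr)
  obtain ⟨C, hC⟩ := exists_cutoff_family
  set K := ∫ r in Ioi (0 : ℝ), u r ^ 2 * ψ r ^ (n - 1)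
  have hbound : ∀ b > (0 : ℝ), ∀ R ≥ b, (p - 1) * ∫ r in (0 : ℝ)..b, Q r ≤ C * K / R ^ 2 := by
    intro b hb R hbR
    have hR : 0 < R := hb.trans_le hbR
    obtain ⟨η, hη, hη0, hη1, hη'⟩ := hC R hR
    have hsub : Icc (0 : ℝ) (2 * R) ⊆ Ici 0 := Icc_subset_Ici_self
    have hcont : ContinuousOn
        (fun r => |u r| ^ (p - 1) * (η r * u r) ^ 2 * ψ r ^ (n - 1)) (Ici 0) :=
      ((hu.1.continuousOn.abs.rpow_const fun r _ => Or.inr (by linarith)).mul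
        ((hη.continuous.continuousOn.mul hu.1.continuousOn).pow 2)).mul (h1.1.continuousOn.pow _)
    calc (p - 1) * ∫ r in (0 : ℝ)..b, Q r
        = (p - 1) * ∫ r in (0 : ℝ)..b,
            |u r| ^ (p - 1) * (η r * u r) ^ 2 * ψ r ^ (n - 1) := by
          congr 1
          refine intervalIntegral.integral_congr fun r hr => ?_
          rw [uIcc_of_le hb.le] at hr
          simp only [hQ]
          rw [hη1 r (by rw [abs_of_nonneg hr.1]; exact hr.2.trans hbR), one_mul]
      _ ≤ (p - 1) * ∫ r in (0 : ℝ)..(2 * R),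
            |u r| ^ (p - 1) * (η r * u r) ^ 2 * ψ r ^ (n - 1) := by
          refine mul_le_mul_of_nonneg_left ?_ (by linarith)
          refine intervalIntegral.integral_mono_interval le_rfl hb.le (by linarith) ?_ ?_
          · filter_upwards [ae_restrict_mem measurableSet_Ioc] with r hr
            exact mul_nonneg (by positivity) (hψ0 r hr.1.le)
          · exact (hcont.mono hsub).intervalIntegrable_of_Icc (by linarith)
      _ ≤ ∫ r in (0 : ℝ)..(2 * R), (deriv η r) ^ 2 * (u r ^ 2 * ψ r ^ (n - 1)) :=
          hstable.integral_le hn2 hp h1 hu (by linarith) hη hη0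
      _ ≤ ∫ r in (0 : ℝ)..(2 * R), C / R ^ 2 * (u r ^ 2 * ψ r ^ (n - 1)) := by
          have hcu : ContinuousOn (fun r => u r ^ 2 * ψ r ^ (n - 1)) (Icc 0 (2 * R)) :=
            ((hu.1.continuousOn.pow 2).mul (h1.1.continuousOn.pow _)).mono hsub
          refine intervalIntegral.integral_mono_on (by linarith) ?_ ?_ fun r hr => ?_
          · exact ContinuousOn.intervalIntegrable_of_Icc (by linarith)
              ((((hη.continuous_deriv le_rfl).pow 2).continuousOn).mul hcu)
          · exact ContinuousOn.intervalIntegrable_of_Icc (by linarith)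
              (continuousOn_const.mul hcu)
          · exact mul_le_mul_of_nonneg_right (hη' r)
              (mul_nonneg (sq_nonneg _) (hψ0 r hr.1))
      _ = C / R ^ 2 * ∫ r in Ioc (0 : ℝ) (2 * R), u r ^ 2 * ψ r ^ (n - 1) := by
          rw [intervalIntegral.integral_const_mul,
            intervalIntegral.integral_of_le (by linarith)]
      _ ≤ C / R ^ 2 * K := by
          refine mul_le_mul_of_nonneg_left ?_ ((sq_nonneg _).trans (hη' 0))
          refine setIntegral_mono_set hL2 ?_ (Eventually.of_forall fun r hr => hr.1)
          filter_upwards [ae_restrict_mem measurableSet_Ioi] with r hr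
          exact mul_nonneg (sq_nonneg _) (hψ0 r (le_of_lt hr))
      _ = C * K / R ^ 2 := by ring
  have hpos : ∀ r > (0 : ℝ), u r = 0 := by
    intro b hb
    by_contra hne
    have hint : 0 < ∫ r in (0 : ℝ)..b, Q r :=
      intervalIntegral.integral_pos hb (hcQ.mono Icc_subset_Ici_self)
        (fun r hr => hQ0 r hr.1.le) ⟨b, right_mem_Icc.2 hb.le,
          mul_pos (by positivity) (pow_pos (hψ b hb) _)⟩
    have hlim : Tendsto (fun R : ℝ => C * K / R ^ 2) atTop (nhds 0) :=
      tendsto_const_nhds.div_atTop (tendsto_pow_atTop two_ne_zero)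
    have hle : (p - 1) * ∫ r in (0 : ℝ)..b, Q r ≤ 0 :=
      ge_of_tendsto hlim ((eventually_ge_atTop b).mono (hbound b hb))
    exact hle.not_gt (mul_pos (by linarith) hint)
  intro r hr
  have hcl : EqOn u (fun _ => 0) (closure (Ioi (0 : ℝ))) :=
    EqOn.of_subset_closure (s := Ioi 0) (fun r hr => hpos r hr)
      (by rw [closure_Ioi]; exact hu.1.continuousOn) continuousOn_const subset_closure le_rfl
  rw [closure_Ioi] at hcl
  exact hcl hr
end
end
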